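/- Let m ∈ ℕ and let U ⊆ ℝ^d be open. For a function f : U → ℝ the following are equivalent: (1) for every smooth curve c ∈ C^∞(ℝ, U) the composite f ∘ c belongs to Z^{m,1}(ℝ); (2) f belongs to Z^{m,1}(U). -/

import Mathlib

/-- Partial derivative of `f` in the `i`-th coordinate direction. -/
noncomputable def pd (d : ℕ) (i : Fin d) (f : EuclideanSpace ℝ (Fin d) → ℝ) :
    EuclideanSpace ℝ (Fin d) → ℝ :=
  fun x => fderiv ℝ f x (EuclideanSpace.single i 1)

/-- Iterated partial derivative `∂^γ f` for a multi-index `γ`. -/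
noncomputable def pdMulti (d : ℕ) (γ : Fin d → ℕ) (f : EuclideanSpace ℝ (Fin d) → ℝ) :
    EuclideanSpace ℝ (Fin d) → ℝ :=
  (List.finRange d).foldr (fun i g => (pd d i)^[γ i] g) f
/-- The local Zygmund class `Z^{m,1}(U)` for `U ⊆ ℝ^d`: `C^m` functions on `U` all of whose
partial derivatives `∂^γ f` with `|γ| = m` satisfy a Zygmund estimate on every compact `K ⊆ U`. -/
def ZygmundClassOn (d m : ℕ) (f : EuclideanSpace ℝ (Fin d) → ℝ)
    (U : Set (EuclideanSpace ℝ (Fin d))) : Prop :=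
  ContDiffOn ℝ m f U ∧
    ∀ γ : Fin d → ℕ, (∑ i, γ i) = m →
      ∀ K : Set (EuclideanSpace ℝ (Fin d)), K ⊆ U → IsCompact K →
        ∃ C : ℝ, ∀ x h : EuclideanSpace ℝ (Fin d),
          x ∈ K → x + h ∈ K → x - h ∈ K → h ≠ 0 →
            |pdMulti d γ f (x + h) - 2 * pdMulti d γ f x + pdMulti d γ f (x - h)| ≤ C * ‖h‖
/-- The local Zygmund class `Z^{m,1}(ℝ)`: `C^m` functions whose `m`-th derivative satisfies a
Zygmund (second difference) estimate on every compact set. -/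
def ZygmundClassR (m : ℕ) (f : ℝ → ℝ) : Prop :=
  ContDiff ℝ m f ∧
    ∀ K : Set ℝ, IsCompact K →
      ∃ C : ℝ, ∀ x h : ℝ, x ∈ K → x + h ∈ K → x - h ∈ K → h ≠ 0 →
        |iteratedDeriv m f (x + h) - 2 * iteratedDeriv m f x + iteratedDeriv m f (x - h)|
          ≤ C * |h|


lemma zy_uniform_of_local {V : Type*} [NormedAddCommGroup V] (A : V → V → ℝ) (B : V → ℝ)
    (hB : ∀ h, 0 ≤ B h) (K : Set V) (hK : IsCompact K)
    (hloc : ∀ a ∈ K, ∃ δ > 0, ∃ C : ℝ, ∀ x h, ‖x - a‖ < δ → ‖h‖ < δ → A x h ≤ C * B h) :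
    ∃ δ > 0, ∃ C : ℝ, 0 ≤ C ∧ ∀ x ∈ K, ∀ h, ‖h‖ < δ → A x h ≤ C * B h := by
  refine hK.induction_on (p := fun s => ∃ δ > 0, ∃ C : ℝ, 0 ≤ C ∧ ∀ x ∈ s, ∀ h, ‖h‖ < δ →
    A x h ≤ C * B h) ?_ ?_ ?_ ?_
  · exact ⟨1, one_pos, 0, le_rfl, by simp⟩
  · rintro s t hst ⟨δ, hδ, C, hC, h⟩
    exact ⟨δ, hδ, C, hC, fun x hx => h x (hst hx)⟩
  · rintro s t ⟨δ, hδ, C, hC, h⟩ ⟨δ', hδ', C', hC', h'⟩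
    refine ⟨min δ δ', lt_min hδ hδ', max C C', le_max_of_le_left hC, ?_⟩
    rintro x (hx | hx) k hk
    · exact (h x hx k (hk.trans_le (min_le_left _ _))).trans
        (mul_le_mul_of_nonneg_right (le_max_left _ _) (hB k))
    · exact (h' x hx k (hk.trans_le (min_le_right _ _))).trans
        (mul_le_mul_of_nonneg_right (le_max_right _ _) (hB k))
  · intro a ha
    obtain ⟨δ, hδ, C, h⟩ := hloc a ha
    refine ⟨Metric.ball a δ, mem_nhdsWithin_of_mem_nhds (Metric.ball_mem_nhds a hδ), δ, hδ,
      max C 0, le_max_right _ _, fun x hx k hk => ?_⟩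
    exact (h x k (by simpa [dist_eq_norm] using hx) hk).trans
      (mul_le_mul_of_nonneg_right (le_max_left _ _) (hB k))

/-- local Zygmund estimate near a point -/
def LZ {V : Type*} [NormedAddCommGroup V] (g : V → ℝ) (a : V) : Prop :=
  ∃ δ > 0, ∃ C : ℝ, ∀ x h, ‖x - a‖ < δ → ‖h‖ < δ → |g (x + h) - 2 * g x + g (x - h)| ≤ C * ‖h‖

lemma zy_compact {V : Type*} [NormedAddCommGroup V] (g : V → ℝ) (K : Set V)
    (hK : IsCompact K) (hg : ContinuousOn g K) (hloc : ∀ a ∈ K, LZ g a) :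
    ∃ C : ℝ, ∀ x h, x ∈ K → x + h ∈ K → x - h ∈ K →
      |g (x + h) - 2 * g x + g (x - h)| ≤ C * ‖h‖ := by
  obtain ⟨δ, hδ, C, hC, h⟩ := zy_uniform_of_local
    (fun x h => |g (x + h) - 2 * g x + g (x - h)|) (fun h => ‖h‖) (fun h => norm_nonneg h) K hK hloc
  obtain ⟨M, hM⟩ := hK.exists_bound_of_continuousOn hg
  refine ⟨max C (4 * M / δ), fun x k hx hx1 hx2 => ?_⟩
  by_cases hk : ‖k‖ < δ
  · exact (h x hx k hk).trans (mul_le_mul_of_nonneg_right (le_max_left _ _) (norm_nonneg _))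
  · push Not at hk
    have h0 := hM x hx
    have h1 := hM _ hx1
    have h2 := hM _ hx2
    rw [Real.norm_eq_abs] at h0 h1 h2
    have hM0 : 0 ≤ M := (abs_nonneg _).trans h0
    have : |g (x + k) - 2 * g x + g (x - k)| ≤ 4 * M := by
      rw [abs_le] at *
      constructor <;> linarith [h0.1, h0.2, h1.1, h1.2, h2.1, h2.2]
    calc _ ≤ 4 * M := this
      _ = 4 * M / δ * δ := by field_simp
      _ ≤ 4 * M / δ * ‖k‖ := by gcongr
      _ ≤ _ := mul_le_mul_of_nonneg_right (le_max_right _ _) (norm_nonneg _)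

lemma zy_lip {W : Type*} [NormedAddCommGroup W] [NormedSpace ℝ W] (u : ℝ → W)
    (hu : ContDiff ℝ 1 u) (K : Set ℝ) (hK : IsCompact K) :
    ∃ L : ℝ, 0 ≤ L ∧ ∀ x ∈ K, ∀ y ∈ K, ‖u x - u y‖ ≤ L * |x - y| := by
  obtain ⟨R, hR⟩ := hK.isBounded.subset_closedBall 0
  obtain ⟨M, hM⟩ := (isCompact_closedBall (0:ℝ) R).exists_bound_of_continuousOn
    (hu.continuous_deriv le_rfl).continuousOn
  refine ⟨max M 0, le_max_right _ _, fun x hx y hy => ?_⟩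
  have := (convex_closedBall (0:ℝ) R).norm_image_sub_le_of_norm_deriv_le (f := u) (C := max M 0)
    (fun x _ => (hu.differentiable one_ne_zero) x) (fun x hx => (hM x hx).trans (le_max_left _ _))
    (hR hy) (hR hx)
  simpa [Real.norm_eq_abs] using this

lemma ZR_zero_iff (f : ℝ → ℝ) : ZygmundClassR 0 f ↔ Continuous f ∧
    ∀ K : Set ℝ, IsCompact K →
      ∃ C : ℝ, ∀ x h : ℝ, x ∈ K → x + h ∈ K → x - h ∈ K → h ≠ 0 →
        |f (x + h) - 2 * f x + f (x - h)| ≤ C * |h| := by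
  simp [ZygmundClassR, contDiff_zero]

lemma ZR_succ_iff (m : ℕ) (f : ℝ → ℝ) : ZygmundClassR (m + 1) f ↔ Differentiable ℝ f ∧
    ZygmundClassR m (deriv f) := by
  unfold ZygmundClassR
  rw [iteratedDeriv_succ']
  push_cast
  rw [contDiff_succ_iff_deriv]
  simp [and_assoc]

lemma ZR_of_contDiff (m : ℕ) (f : ℝ → ℝ) (hf : ContDiff ℝ (m + 1 : ℕ) f) : ZygmundClassR m f := by
  induction m generalizing f with
  | zero =>
    rw [ZR_zero_iff]
    refine ⟨hf.continuous, fun K hK => ?_⟩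
    obtain ⟨L, hL, h⟩ := zy_lip f (by simpa using hf) K hK
    refine ⟨2 * L, fun x k hx hx1 hx2 _ => ?_⟩
    have h1 := h _ hx1 _ hx
    have h2 := h _ hx2 _ hx
    simp only [add_sub_cancel_left, sub_sub_cancel_left, abs_neg, Real.norm_eq_abs] at h1 h2
    calc _ = |(f (x + k) - f x) + (f (x - k) - f x)| := by ring_nf
      _ ≤ _ := abs_add_le _ _
      _ ≤ _ := by linarith
  | succ m ih =>
    rw [ZR_succ_iff]
    have := contDiff_succ_iff_deriv.1 (by simpa using hf : ContDiff ℝ (((m + 1 : ℕ) : WithTop ℕ∞) + 1) f)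
    exact ⟨this.1, ih _ this.2.2⟩

lemma ZR_mono (m : ℕ) (f : ℝ → ℝ) (hf : ZygmundClassR (m + 1) f) : ZygmundClassR m f :=
  ZR_of_contDiff m f hf.1

lemma ZR_add (m : ℕ) (f g : ℝ → ℝ) (hf : ZygmundClassR m f) (hg : ZygmundClassR m g) :
    ZygmundClassR m (fun x => f x + g x) := by
  induction m generalizing f g with
  | zero =>
    rw [ZR_zero_iff] at *
    refine ⟨hf.1.add hg.1, fun K hK => ?_⟩
    obtain ⟨C, h⟩ := hf.2 K hK
    obtain ⟨C', h'⟩ := hg.2 K hK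
    refine ⟨C + C', fun x k hx hx1 hx2 hk => ?_⟩
    calc _ = |(f (x + k) - 2 * f x + f (x - k)) + (g (x + k) - 2 * g x + g (x - k))| := by ring_nf
      _ ≤ _ := abs_add_le _ _
      _ ≤ _ := by linarith [h x k hx hx1 hx2 hk, h' x k hx hx1 hx2 hk]
  | succ m ih =>
    rw [ZR_succ_iff] at *
    refine ⟨hf.1.add hg.1, ?_⟩
    convert ih _ _ hf.2 hg.2 using 1
    ext x
    exact deriv_add (hf.1 x) (hg.1 x)

lemma ZR_const (m : ℕ) (c : ℝ) : ZygmundClassR m (fun _ => c) :=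
  ZR_of_contDiff m _ contDiff_const

lemma ZR_sum {ι : Type*} (m : ℕ) (s : Finset ι) (f : ι → ℝ → ℝ)
    (hf : ∀ i, ZygmundClassR m (f i)) : ZygmundClassR m (fun x => ∑ i ∈ s, f i x) := by
  classical
  induction s using Finset.induction_on with
  | empty => simpa using ZR_const m 0
  | insert a s ha ih =>
    simp only [Finset.sum_insert ha]
    exact ZR_add m _ _ (hf a) ih

lemma ZR_mul (m : ℕ) (u g : ℝ → ℝ) (hu : ContDiff ℝ (⊤ : ℕ∞) u) (hg : ZygmundClassR m g) :
    ZygmundClassR m (fun x => u x * g x) := by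
  induction m generalizing u g with
  | zero =>
    rw [ZR_zero_iff] at *
    refine ⟨hu.continuous.mul hg.1, fun K hK => ?_⟩
    obtain ⟨C, h⟩ := hg.2 K hK
    obtain ⟨L, hL, hl⟩ := zy_lip u (hu.of_le (by exact_mod_cast le_top)) K hK
    obtain ⟨M, hM⟩ := hK.exists_bound_of_continuousOn hg.1.continuousOn
    obtain ⟨M', hM'⟩ := hK.exists_bound_of_continuousOn hu.continuous.continuousOn
    refine ⟨M' * C + 2 * (L * M), fun x k hx hx1 hx2 hk => ?_⟩
    have h1 := hl _ hx1 _ hx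
    have h2 := hl _ hx2 _ hx
    simp only [add_sub_cancel_left, sub_sub_cancel_left, abs_neg, Real.norm_eq_abs] at h1 h2
    have h3 := h x k hx hx1 hx2 hk
    have h4 := hM _ hx1
    have h5 := hM _ hx2
    have h6 := hM' _ hx
    rw [Real.norm_eq_abs] at h4 h5 h6
    calc _ = |u x * (g (x + k) - 2 * g x + g (x - k)) + ((u (x + k) - u x) * g (x + k)
          + (u (x - k) - u x) * g (x - k))| := by ring_nf
      _ ≤ |u x| * |g (x + k) - 2 * g x + g (x - k)| + (|u (x + k) - u x| * |g (x + k)|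
          + |u (x - k) - u x| * |g (x - k)|) := by
          rw [← abs_mul, ← abs_mul, ← abs_mul]
          exact (abs_add_le _ _).trans (add_le_add le_rfl (abs_add_le _ _))
      _ ≤ M' * (C * |k|) + (L * |k| * M + L * |k| * M) := by gcongr; exact (abs_nonneg _).trans h6
      _ = _ := by ring
  | succ m ih =>
    have hg' := ZR_mono m g hg
    rw [ZR_succ_iff] at *
    have hud : Differentiable ℝ u := hu.differentiable (by simp)
    refine ⟨hud.mul hg.1, ?_⟩
    have hu' : ContDiff ℝ (⊤ : ℕ∞) (deriv u) := by
      exact (contDiff_infty_iff_deriv.1 hu).2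
    convert ZR_add m _ _ (ih _ _ hu' hg') (ih _ _ hu hg.2) using 1
    ext x
    exact deriv_mul (hud x) (hg.1 x)


lemma ZR_diff (m : ℕ) (g : ℝ → ℝ) (hg : ZygmundClassR m g) (R : ℝ) :
    ∃ A : ℝ, 0 ≤ A ∧ ∀ t h, 0 < h → -R ≤ t → t + (m + 2) * h ≤ R →
      |(fwdDiff h)^[m + 2] g t| ≤ A * h ^ (m + 1) := by
  induction m generalizing g with
  | zero =>
    rw [ZR_zero_iff] at hg
    obtain ⟨C, h⟩ := hg.2 (Set.Icc (-R) R) isCompact_Icc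
    refine ⟨max C 0, le_max_right _ _, fun t k hk ht1 ht2 => ?_⟩
    have := h (t + k) k (by constructor <;> push_cast at ht2 <;> linarith)
      (by constructor <;> push_cast at ht2 <;> linarith)
      (by constructor <;> push_cast at ht2 <;> linarith) hk.ne'
    calc |(fwdDiff k)^[0 + 2] g t| = |g (t + k + k) - 2 * g (t + k) + g (t + k - k)| := by
          simp only [zero_add, Function.iterate_succ, Function.iterate_zero, Function.comp, id, fwdDiff]
          ring_nf
      _ ≤ C * |k| := this
      _ ≤ _ := by
        rw [abs_of_pos hk]; simp only [zero_add, pow_one]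
        exact mul_le_mul_of_nonneg_right (le_max_left _ _) hk.le
  | succ m ih =>
    rw [ZR_succ_iff] at hg
    obtain ⟨A, hA, h⟩ := ih _ hg.2
    refine ⟨A, hA, fun t k hk ht1 ht2 => ?_⟩
    have hder : ∀ n : ℕ, ∀ s, HasDerivAt ((fwdDiff k)^[n] g) ((fwdDiff k)^[n] (deriv g) s) s := by
      intro n
      induction n with
      | zero => intro s; exact (hg.1 s).hasDerivAt
      | succ n ihn =>
        intro s
        rw [Function.iterate_succ_apply', Function.iterate_succ_apply']
        exact ((ihn (s + k)).comp_add_const s k).sub (ihn s)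
    rw [show m + 1 + 2 = (m + 2) + 1 by ring, Function.iterate_succ_apply']
    push_cast at ht2
    have := (convex_Icc t (t + k)).norm_image_sub_le_of_norm_hasDerivWithin_le
      (f := (fwdDiff k)^[m+2] g) (C := A * k ^ (m + 1)) (x := t) (y := t + k)
      (fun s _ => (hder _ s).hasDerivWithinAt)
      (fun s hs => h s k hk (ht1.trans hs.1) (by linarith [hs.2]))
      ⟨le_rfl, by linarith⟩ ⟨by linarith, le_rfl⟩
    simp only [fwdDiff, Real.norm_eq_abs, add_sub_cancel_left, abs_of_pos hk] at this ⊢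
    rw [pow_succ, ← mul_assoc]
    exact this

lemma zy_summable (k : ℕ) : Summable (fun n : ℕ => (2 ^ n : ℝ) ^ k * (1 / 2 : ℝ) ^ (n * n)) := by
  refine Summable.of_nonneg_of_le (fun n => by positivity) (fun n => ?_)
    ((summable_geometric_two).mul_left ((2:ℝ) ^ ((k + 1) * (k + 1))))
  have h : n * k + n ≤ (k + 1) * (k + 1) + n * n := by nlinarith [sq_nonneg ((n : ℤ) - k - 1)]
  have h2 : (2:ℝ) ^ (n * k + n) ≤ 2 ^ ((k + 1) * (k + 1) + n * n) :=
    pow_le_pow_right₀ (by norm_num) h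
  rw [pow_add, pow_add] at h2
  rw [← pow_mul, one_div, inv_pow, inv_pow, ← div_eq_mul_inv, ← div_eq_mul_inv,
    div_le_div_iff₀ (by positivity) (by positivity)]
  exact h2

lemma zy_iter_bound (χ : ℝ → ℝ) (h : ContDiff ℝ (⊤ : ℕ∞) χ) (hc : HasCompactSupport χ) (k : ℕ) :
    ∃ M : ℝ, 0 ≤ M ∧ ∀ x, |iteratedDeriv k χ x| ≤ M := by
  obtain ⟨M, hM⟩ := (hc.iteratedFDeriv (𝕜 := ℝ) k).exists_bound_of_continuous
    (h.continuous_iteratedFDeriv (m := k) (by exact_mod_cast le_top))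
  refine ⟨M, (norm_nonneg _).trans (hM 0), fun x => ?_⟩
  rw [← Real.norm_eq_abs, ← norm_iteratedFDeriv_eq_norm_iteratedDeriv]
  exact hM x

lemma zy_curve {E : Type*} [NormedAddCommGroup E] [NormedSpace ℝ E] [CompleteSpace E]
    (a : E) (p q : ℕ → E) (ρ : ℝ) (hρ : 0 ≤ ρ) (hp : ∀ n, ‖p n‖ ≤ ρ * (1 / 2) ^ (n * n))
    (hq : ∀ n, ‖q n‖ ≤ ρ * (1 / 2) ^ (n * n)) :
    ∃ c : ℝ → E, ContDiff ℝ (⊤ : ℕ∞) c ∧ (∀ t, ‖c t - a‖ ≤ 2 * ρ) ∧ c 0 = a ∧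
      ∀ n s, |s| ≤ 1 / 8 → c ((1 + s) / 2 ^ n) = a + p n + s • q n := by
  let χ : ContDiffBump (0 : ℝ) := ⟨1 / 8, 1 / 4, by norm_num, by norm_num⟩
  have hz : ∀ s : ℝ, 1 / 4 ≤ |s| → χ s = 0 := fun s hs =>
    χ.zero_of_le_dist (by rw [Real.dist_eq, sub_zero]; exact hs)
  have ho : ∀ s : ℝ, |s| ≤ 1 / 8 → χ s = 1 := fun s hs =>
    χ.one_of_mem_closedBall (by rw [Metric.mem_closedBall, Real.dist_eq, sub_zero]; exact hs)
  let χ1 : ℝ → ℝ := fun z => χ (z - 1)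
  let χ2 : ℝ → ℝ := fun z => (z - 1) * χ (z - 1)
  have hs1 : ContDiff ℝ (⊤ : ℕ∞) χ1 := χ.contDiff.comp (contDiff_id.sub contDiff_const)
  have hs2 : ContDiff ℝ (⊤ : ℕ∞) χ2 := (contDiff_id.sub contDiff_const).mul hs1
  have hc1 : HasCompactSupport χ1 := by
    refine HasCompactSupport.intro (isCompact_closedBall (1:ℝ) (1/4)) (fun x hx => ?_)
    rw [Metric.mem_closedBall, Real.dist_eq, not_le] at hx
    exact hz _ hx.le
  have hc2 : HasCompactSupport χ2 := hc1.mul_left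
  let G : ℕ → ℝ → E := fun n t => χ1 (2 ^ n * t) • p n + χ2 (2 ^ n * t) • q n
  have hG : ∀ n, ContDiff ℝ (⊤ : ℕ∞) (G n) := fun n =>
    ((hs1.comp (contDiff_const.mul contDiff_id)).smul contDiff_const).add
      ((hs2.comp (contDiff_const.mul contDiff_id)).smul contDiff_const)
  choose M1 hM1 hM1' using zy_iter_bound χ1 hs1 hc1
  choose M2 hM2 hM2' using zy_iter_bound χ2 hs2 hc2
  have hsm : ContDiff ℝ (⊤ : ℕ∞) (fun t => ∑' n, G n t) := by
    refine contDiff_tsum (v := fun k n => (M1 k + M2 k) * ρ * ((2 ^ n : ℝ) ^ k * (1 / 2 : ℝ) ^ (n * n)))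
      hG (fun k _ => (zy_summable k).mul_left _) ?_
    intro k n x _
    rw [norm_iteratedFDeriv_eq_norm_iteratedDeriv]
    have e1 : ∀ z, ContDiffAt ℝ k χ1 z := fun z => (hs1.of_le (by exact_mod_cast le_top)).contDiffAt
    have e2 : ∀ z, ContDiffAt ℝ k χ2 z := fun z => (hs2.of_le (by exact_mod_cast le_top)).contDiffAt
    have : iteratedDeriv k (G n) x = (2 ^ n : ℝ) ^ k •
        (iteratedDeriv k χ1 (2 ^ n * x) • p n + iteratedDeriv k χ2 (2 ^ n * x) • q n) := by
      have h1 := congrFun (iteratedDeriv_comp_const_smul (n := k)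
        (f := fun z => χ1 z • p n + χ2 z • q n)
        (((hs1.smul contDiff_const).add (hs2.smul contDiff_const)).of_le (by exact_mod_cast le_top))
        (2 ^ n : ℝ)) x
      refine h1.trans ?_
      congr 1
      have h2 := iteratedDeriv_add (n := k) (x := 2 ^ n * x) (f := fun z => χ1 z • p n)
        (g := fun z => χ2 z • q n) ((e1 _).smul contDiffAt_const) ((e2 _).smul contDiffAt_const)
      refine h2.trans ?_
      rw [iteratedDeriv_smul_const (e1 _), iteratedDeriv_smul_const (e2 _)]
    rw [this, norm_smul, Real.norm_of_nonneg (by positivity)]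
    calc _ ≤ (2 ^ n : ℝ) ^ k * (M1 k * (ρ * (1 / 2) ^ (n * n)) + M2 k * (ρ * (1 / 2) ^ (n * n))) := by
          gcongr
          refine (norm_add_le _ _).trans ?_
          rw [norm_smul, norm_smul]
          gcongr
          · exact hM1 k
          · exact hM1' k _
          · exact hp n
          · exact hM2 k
          · exact hM2' k _
          · exact hq n
      _ = _ := by ring
  have hG0 : ∀ n t, 1 / 4 ≤ |2 ^ n * t - 1| → G n t = 0 := by
    intro n t h
    simp [G, χ1, χ2, hz _ h]
  have huniq0 : ∀ (n k : ℕ) (t : ℝ), n < k → |2 ^ n * t - 1| < 1 / 4 → 1 / 4 ≤ |2 ^ k * t - 1| := by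
    intro n k t hnk h
    rw [abs_lt] at h
    obtain ⟨j, rfl⟩ := Nat.exists_eq_add_of_lt hnk
    rw [show n + j + 1 = n + (j + 1) by ring, pow_add, pow_succ]
    have : (1:ℝ) ≤ 2 ^ j := one_le_pow₀ (by norm_num)
    refine le_trans ?_ (le_abs_self _)
    nlinarith [mul_nonneg (show (0:ℝ) ≤ 2 ^ n * t by linarith) (show (0:ℝ) ≤ 2 ^ j - 1 by linarith)]
  have huniq : ∀ (n k : ℕ) (t : ℝ), k ≠ n → |2 ^ n * t - 1| < 1 / 4 → 1 / 4 ≤ |2 ^ k * t - 1| := by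
    intro n k t hnk h
    rcases lt_or_gt_of_ne hnk with h1 | h1
    · by_contra! h2
      exact absurd h (not_lt.2 (huniq0 k n t h1 h2))
    · exact huniq0 n k t h1 h
  have hval : ∀ (n : ℕ) (t : ℝ), |2 ^ n * t - 1| < 1 / 4 → ∑' n, G n t = G n t := fun n t h =>
    tsum_eq_single n (fun k hk => hG0 k t (huniq n k t hk h))
  refine ⟨fun t => a + ∑' n, G n t, contDiff_const.add hsm, ?_, ?_, ?_⟩
  · intro t
    rw [add_sub_cancel_left]
    by_cases h : ∃ n : ℕ, |2 ^ n * t - 1| < 1 / 4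
    · obtain ⟨n, hn⟩ := h
      rw [hval n t hn]
      have hle : ∀ n, ρ * (1 / 2 : ℝ) ^ (n * n) ≤ ρ := fun n =>
        mul_le_of_le_one_right hρ (pow_le_one₀ (by norm_num) (by norm_num))
      have c1 : ‖χ1 (2 ^ n * t)‖ ≤ 1 := by
        rw [Real.norm_of_nonneg χ.nonneg]; exact χ.le_one
      have c2 : ‖χ2 (2 ^ n * t)‖ ≤ 1 := by
        simp only [χ2, norm_mul]
        refine mul_le_one₀ ?_ (norm_nonneg _) c1
        rw [Real.norm_eq_abs]; linarith
      calc _ ≤ ‖χ1 (2 ^ n * t)‖ * ‖p n‖ + ‖χ2 (2 ^ n * t)‖ * ‖q n‖ := by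
            rw [← norm_smul, ← norm_smul]; exact norm_add_le _ _
        _ ≤ 1 * ρ + 1 * ρ := by
          gcongr
          · exact (hp n).trans (hle n)
          · exact (hq n).trans (hle n)
        _ = 2 * ρ := by ring
    · push Not at h
      have : ∑' n, G n t = 0 := by
        rw [tsum_congr (fun n => hG0 n t (h n)), tsum_zero]
      rw [this, norm_zero]; positivity
  · have : ∑' n, G n 0 = 0 := by
      rw [tsum_congr (fun n => hG0 n 0 (by norm_num)), tsum_zero]
    simp [this]
  · intro n s hs
    have e : (2:ℝ) ^ n * ((1 + s) / 2 ^ n) = 1 + s := by field_simp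
    have := hval n ((1 + s) / 2 ^ n) (by rw [e, add_sub_cancel_left]; linarith)
    simp only [this]
    simp only [G, χ1, χ2, e, add_sub_cancel_left, ho s hs]
    simp [add_assoc]

/-- testing continuity along curves -/
lemma zy_continuousAt {E : Type*} [NormedAddCommGroup E] [NormedSpace ℝ E] [CompleteSpace E]
    (U : Set E) (hU : IsOpen U) (f : E → ℝ)
    (H : ∀ c : ℝ → E, ContDiff ℝ (⊤ : ℕ∞) c → (∀ t, c t ∈ U) → Continuous (f ∘ c))
    (a : E) (ha : a ∈ U) : ContinuousAt f a := by
  obtain ⟨r, hr, hrU⟩ := Metric.isOpen_iff.1 hU a ha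
  by_contra hcon
  rw [Metric.continuousAt_iff] at hcon
  push Not at hcon
  obtain ⟨ε, hε, h⟩ := hcon
  have h' : ∀ n : ℕ, ∃ x, dist x a < r / 4 * (1 / 2) ^ (n * n) ∧ ε ≤ dist (f x) (f a) :=
    fun n => by
      obtain ⟨x, h1, h2⟩ := h (r / 4 * (1 / 2) ^ (n * n)) (by positivity)
      exact ⟨x, h1, h2⟩
  choose x hx hx' using h'
  obtain ⟨c, hc, hca, hc0, hcv⟩ := zy_curve a (fun n => x n - a) (fun _ => 0) (r / 4) (by positivity)
    (fun n => by simpa [dist_eq_norm] using (hx n).le) (fun n => by simp; positivity)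
  have hcont := H c hc (fun t => hrU (by
    rw [Metric.mem_ball, dist_eq_norm]; linarith [hca t]))
  have ht : Filter.Tendsto (fun n : ℕ => (1:ℝ) / 2 ^ n) Filter.atTop (nhds 0) := by
    simpa using tendsto_pow_atTop_nhds_zero_of_lt_one (r := (1 / 2 : ℝ)) (by norm_num) (by norm_num)
  have h2 := (hcont.tendsto 0).comp ht
  have h3 : ∀ n : ℕ, (f ∘ c) (1 / 2 ^ n) = f (x n) := by
    intro n
    have := hcv n 0 (by norm_num)
    simp at this
    simp [this]
  rw [Metric.tendsto_atTop] at h2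
  obtain ⟨N, hN⟩ := h2 ε hε
  have := hN N le_rfl
  simp only [Function.comp_apply] at this h3
  rw [h3, hc0] at this
  exact absurd this (not_lt.2 (hx' N))

/-- testing difference estimates along curves -/
lemma zy_local_diff {E : Type*} [NormedAddCommGroup E] [NormedSpace ℝ E] [CompleteSpace E]
    (U : Set E) (hU : IsOpen U) (f : E → ℝ) (m : ℕ)
    (H : ∀ c : ℝ → E, ContDiff ℝ (⊤ : ℕ∞) c → (∀ t, c t ∈ U) → ZygmundClassR m (f ∘ c))
    (a : E) (ha : a ∈ U) : ∃ δ > 0, ∃ C : ℝ, ∀ x v, ‖x - a‖ < δ → ‖v‖ < δ →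
      |(fwdDiff v)^[m + 2] f x| ≤ C * ‖v‖ ^ (m + 1) := by
  obtain ⟨r, hr, hrU⟩ := Metric.isOpen_iff.1 hU a ha
  by_contra! hcon
  -- radii
  let ρ : ℕ → ℝ := fun n => r / 4 * (1 / 2) ^ (n * n)
  have hρ : ∀ n, 0 < ρ n := fun n => by positivity
  have h' : ∀ n : ℕ, ∃ x v, ‖x - a‖ < ρ n ∧ ‖v‖ < ρ n / (8 * (m + 2)) ∧
      n * (1 / ρ n) ^ (m + 1) * ‖v‖ ^ (m + 1) < |(fwdDiff v)^[m + 2] f x| := fun n => by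
    obtain ⟨x, v, h1, h2, h3⟩ := hcon (min (ρ n) (ρ n / (8 * (m + 2))))
      (lt_min (hρ n) (by have := hρ n; positivity)) (n * (1 / ρ n) ^ (m + 1))
    exact ⟨x, v, h1.trans_le (min_le_left _ _), h2.trans_le (min_le_right _ _), h3⟩
  choose x v hx hv hxv using h'
  have hv0 : ∀ n, v n ≠ 0 := by
    intro n h0
    have := hxv n
    rw [h0, Function.iterate_succ_apply'] at this
    simp [fwdDiff] at this
  have hvn : ∀ n, 0 < ‖v n‖ := fun n => norm_pos_iff.2 (hv0 n)
  obtain ⟨c, hc, hca, hc0, hcv⟩ := zy_curve a (fun n => x n - a)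
    (fun n => (ρ n / ‖v n‖) • v n) (r / 4) (by positivity)
    (fun n => (hx n).le) (fun n => by
      rw [norm_smul, Real.norm_of_nonneg (div_nonneg (hρ n).le (hvn n).le),
        div_mul_cancel₀ _ (hvn n).ne'])
  have hz := H c hc (fun t => hrU (by
    rw [Metric.mem_ball, dist_eq_norm]; linarith [hca t]))
  obtain ⟨A, hA, hdiff⟩ := ZR_diff m _ hz 2
  obtain ⟨n, hn⟩ := exists_nat_gt A
  set θ : ℝ := ‖v n‖ / ρ n with hθ
  have hθ0 : 0 < θ := div_pos (hvn n) (hρ n)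
  have hθ1 : (m + 2) * θ ≤ 1 / 8 := by
    have h1 := (hv n).le
    rw [hθ, ← mul_div_assoc, div_le_iff₀ (hρ n)]
    rw [le_div_iff₀ (by positivity)] at h1
    linarith
  have h2n : (1:ℝ) ≤ 2 ^ n := one_le_pow₀ (by norm_num)
  have key := hdiff (1 / 2 ^ n) (θ / 2 ^ n) (by positivity)
    (by have : (0:ℝ) ≤ 1 / 2 ^ n := by positivity
        linarith) (by
      have : 1 / 2 ^ n + ((m:ℝ) + 2) * (θ / 2 ^ n) = (1 + (m + 2) * θ) / 2 ^ n := by ring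
      rw [this, div_le_iff₀ (by positivity)]
      nlinarith)
  have hsame : (fwdDiff (θ / 2 ^ n))^[m + 2] (f ∘ c) (1 / 2 ^ n) = (fwdDiff (v n))^[m + 2] f (x n) := by
    rw [fwdDiff_iter_eq_sum_shift, fwdDiff_iter_eq_sum_shift]
    refine Finset.sum_congr rfl (fun k hk => ?_)
    congr 1
    have hk' : (k : ℝ) ≤ m + 2 := by
      have := Finset.mem_range_succ_iff.1 hk
      exact_mod_cast this
    have := hcv n (k * θ) (by
      rw [abs_of_nonneg (by positivity)]
      refine le_trans ?_ hθ1
      gcongr)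
    have e : (1:ℝ) / 2 ^ n + k • (θ / 2 ^ n) = (1 + k * θ) / 2 ^ n := by
      rw [nsmul_eq_mul]; ring
    rw [Function.comp_apply, e, this, smul_smul]
    have e2 : (k:ℝ) * θ * (ρ n / ‖v n‖) = k := by
      rw [hθ]; have := hρ n; have := hvn n; field_simp
    rw [e2, add_sub_cancel, Nat.cast_smul_eq_nsmul]
  rw [hsame] at key
  have h3 := (hxv n).trans_le key
  have h4 : A * (θ / 2 ^ n) ^ (m + 1) ≤ A * θ ^ (m + 1) := by
    gcongr
    exact div_le_self hθ0.le h2n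
  have h5 : (n:ℝ) * (1 / ρ n) ^ (m + 1) * ‖v n‖ ^ (m + 1) = n * θ ^ (m + 1) := by
    rw [mul_assoc, ← mul_pow, hθ]; congr 2; ring
  rw [h5] at h3
  have : A * θ ^ (m + 1) ≤ n * θ ^ (m + 1) := by gcongr
  linarith

section ZyConv
open MeasureTheory Convolution

variable {E : Type} [NormedAddCommGroup E] [InnerProductSpace ℝ E] [FiniteDimensional ℝ E]
  [MeasurableSpace E] [BorelSpace E]

lemma zy_conv_bound (k : ℕ) : ∀ (W W' : Type) [NormedAddCommGroup W] [NormedSpace ℝ W]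
    [NormedAddCommGroup W'] [NormedSpace ℝ W'] [CompleteSpace W'] (L : W →L[ℝ] ℝ →L[ℝ] W')
    (ψ : E → W), ContDiff ℝ (⊤ : ℕ∞) ψ → HasCompactSupport ψ →
    ∃ A : ℝ, 0 ≤ A ∧ ∀ (G : E → ℝ) (M : ℝ), Continuous G → (∀ x, |G x| ≤ M) → ∀ x,
      ‖iteratedFDeriv ℝ k (ψ ⋆[L, volume] G) x‖ ≤ A * M := by
  induction k with
  | zero =>
    intro W W' _ _ _ _ _ L ψ hψ hc
    refine ⟨∫ t, ‖L‖ * ‖ψ t‖, integral_nonneg (fun t => by positivity), fun G M hG hM x => ?_⟩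
    rw [norm_iteratedFDeriv_zero, convolution_def, ← integral_mul_const]
    have hintg : Integrable ψ := hψ.continuous.integrable_of_hasCompactSupport hc
    refine norm_integral_le_of_norm_le ((hintg.norm.const_mul _).mul_const _)
      (Filter.Eventually.of_forall (fun t => ?_))
    refine (L.le_opNorm₂ _ _).trans ?_
    gcongr
    exact hM _
  | succ k ih =>
    intro W W' _ _ _ _ _ L ψ hψ hc
    obtain ⟨A, hA, h⟩ := ih (E →L[ℝ] W) (E →L[ℝ] W') (L.precompL E) (fderiv ℝ ψ)
      (hψ.fderiv_right (by simp)) (hc.fderiv ℝ)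
    refine ⟨A, hA, fun G M hG hM x => ?_⟩
    rw [← norm_iteratedFDeriv_fderiv]
    have : fderiv ℝ (ψ ⋆[L, volume] G) = (fderiv ℝ ψ) ⋆[L.precompL E, volume] G := by
      ext1 y
      exact (hc.hasFDerivAt_convolution_left L (hψ.of_le (by exact_mod_cast le_top))
        hG.locallyIntegrable y).fderiv
    rw [this]
    exact h G M hG hM x

/-- averages -/
noncomputable def SS (φ : E → ℝ) (l : ℝ) (G : E → ℝ) (x : E) : ℝ := ∫ y, φ y * G (x - l • y)

lemma SS_integrable (φ : E → ℝ) (hφ : Continuous φ) (hc : HasCompactSupport φ) (l : ℝ)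
    (G : E → ℝ) (hG : Continuous G) (x : E) : Integrable (fun y => φ y * G (x - l • y)) := by
  refine Continuous.integrable_of_hasCompactSupport (by fun_prop) hc.mul_right

lemma SS_contDiff (φ : E → ℝ) (hφ : ContDiff ℝ (⊤ : ℕ∞) φ) (hc : HasCompactSupport φ)
    (l : ℝ) (hl : 0 < l) (G : E → ℝ) (hG : Continuous G) : ContDiff ℝ (⊤ : ℕ∞) (SS φ l G) ∧
    SS φ l G = fun x => (φ ⋆[ContinuousLinearMap.lsmul ℝ ℝ, volume] (fun z => G (l • z))) (l⁻¹ • x) := by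
  have e : SS φ l G = fun x =>
      (φ ⋆[ContinuousLinearMap.lsmul ℝ ℝ, volume] (fun z => G (l • z))) (l⁻¹ • x) := by
    ext x
    rw [SS, convolution_def]
    congr 1
    ext y
    simp [smul_sub, smul_smul, hl.ne']
  refine ⟨?_, e⟩
  rw [e]
  exact (hc.contDiff_convolution_left _ hφ
    (Continuous.locallyIntegrable (by fun_prop))).comp (contDiff_const_smul _)

lemma SS_bound (φ : E → ℝ) (hφ : ContDiff ℝ (⊤ : ℕ∞) φ) (hc : HasCompactSupport φ) (k : ℕ) :
    ∃ A : ℝ, 0 ≤ A ∧ ∀ (l : ℝ), 0 < l → ∀ (G : E → ℝ) (M : ℝ), Continuous G → (∀ x, |G x| ≤ M) →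
      ∀ x, ‖iteratedFDeriv ℝ k (SS φ l G) x‖ ≤ A * M / l ^ k := by
  obtain ⟨A, hA, h⟩ := zy_conv_bound (E := E) k ℝ ℝ (ContinuousLinearMap.lsmul ℝ ℝ) φ hφ hc
  refine ⟨A, hA, fun l hl G M hG hM x => ?_⟩
  rw [(SS_contDiff φ hφ hc l hl G hG).2]
  have hs : ContDiff ℝ k (φ ⋆[ContinuousLinearMap.lsmul ℝ ℝ, volume] (fun z => G (l • z))) :=
    hc.contDiff_convolution_left _ (hφ.of_le (by exact_mod_cast le_top))
      (Continuous.locallyIntegrable (by fun_prop))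
  rw [iteratedFDeriv_comp_const_smul _ hs]
  simp only
  rw [norm_smul, norm_pow, Real.norm_of_nonneg (inv_nonneg.2 hl.le), inv_pow, div_eq_mul_inv, mul_comm]
  gcongr
  exact h _ M (by fun_prop) (fun z => hM _) _

lemma SS_sum (φ : E → ℝ) (hφ : Continuous φ) (hc : HasCompactSupport φ) (l : ℝ)
    {ι : Type} (s : Finset ι) (a : ι → ℝ) (G : ι → E → ℝ) (hG : ∀ i, Continuous (G i)) (x : E) :
    SS φ l (fun z => ∑ i ∈ s, a i * G i z) x = ∑ i ∈ s, a i * SS φ l (G i) x := by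
  simp only [SS]
  simp_rw [← integral_const_mul]
  rw [← integral_finsetSum]
  · congr 1
    ext y
    rw [Finset.mul_sum]
    exact Finset.sum_congr rfl (fun i _ => by ring)
  · intro i _
    exact (SS_integrable φ hφ hc l (G i) (hG i) x).const_mul _

lemma SS_comm (φ : E → ℝ) (hφ : Continuous φ) (hc : HasCompactSupport φ) (l l' : ℝ)
    (G : E → ℝ) (hG : Continuous G) (x : E) :
    SS φ l (SS φ l' G) x = SS φ l' (SS φ l G) x := by
  simp only [SS]
  simp_rw [← integral_const_mul]
  rw [integral_integral_swap]
  · congr 1; ext y; congr 1; ext z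
    rw [sub_right_comm]; ring
  · refine Continuous.integrable_of_hasCompactSupport (by simp only [Function.uncurry_def]; fun_prop) ?_
    refine HasCompactSupport.intro (hc.prod hc) (fun y hy => ?_)
    simp only [Set.mem_prod, not_and_or] at hy
    rcases hy with h | h
    · simp [Function.uncurry_def, image_eq_zero_of_notMem_tsupport h]
    · simp [Function.uncurry_def, image_eq_zero_of_notMem_tsupport h]

/-- coefficients of the higher order mollifier -/
noncomputable def cc (N k : ℕ) : ℝ := -((-1) ^ N * ((-1) ^ (N - (k + 1)) * (N.choose (k + 1))))

/-- higher order mollification -/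
noncomputable def TT (φ : E → ℝ) (N : ℕ) (l : ℝ) (G : E → ℝ) (x : E) : ℝ :=
  ∑ k ∈ Finset.range N, cc N k * SS φ ((k + 1) * l) G x

lemma TT_contDiff (φ : E → ℝ) (hφ : ContDiff ℝ (⊤ : ℕ∞) φ) (hc : HasCompactSupport φ) (N : ℕ)
    (l : ℝ) (hl : 0 < l) (G : E → ℝ) (hG : Continuous G) : ContDiff ℝ (⊤ : ℕ∞) (TT φ N l G) :=
  ContDiff.sum (fun k _ => contDiff_const.mul (SS_contDiff φ hφ hc _ (by positivity) G hG).1)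

lemma TT_bound (φ : E → ℝ) (hφ : ContDiff ℝ (⊤ : ℕ∞) φ) (hc : HasCompactSupport φ) (N k : ℕ) :
    ∃ A : ℝ, 0 ≤ A ∧ ∀ (l : ℝ), 0 < l → ∀ (G : E → ℝ) (M : ℝ), Continuous G → (∀ x, |G x| ≤ M) →
      ∀ x, ‖iteratedFDeriv ℝ k (TT φ N l G) x‖ ≤ A * M / l ^ k := by
  obtain ⟨A, hA, h⟩ := SS_bound φ hφ hc k
  refine ⟨∑ j ∈ Finset.range N, |cc N j| * A, Finset.sum_nonneg (fun _ _ => by positivity),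
    fun l hl G M hG hM x => ?_⟩
  have hM0 : 0 ≤ M := (abs_nonneg _).trans (hM 0)
  have hs : ∀ j : ℕ, ContDiff ℝ k (SS φ ((j + 1) * l) G) := fun j =>
    (SS_contDiff φ hφ hc _ (by positivity) G hG).1.of_le (by exact_mod_cast le_top)
  have e : iteratedFDeriv ℝ k (TT φ N l G) x =
      ∑ j ∈ Finset.range N, cc N j • iteratedFDeriv ℝ k (SS φ ((j + 1) * l) G) x := by
    have : TT φ N l G = fun x => ∑ j ∈ Finset.range N, (cc N j • SS φ ((j + 1) * l) G) x := by
      ext x; simp [TT]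
    have h1 := iteratedFDeriv_fun_sum_apply (𝕜 := ℝ) (u := Finset.range N)
      (f := fun (j : ℕ) => cc N j • SS φ ((j + 1) * l) G) (n := k) (x := x)
      (fun j _ => ((hs j).contDiffAt.const_smul (cc N j)))
    rw [this]
    refine h1.trans ?_
    exact Finset.sum_congr rfl (fun j _ => iteratedFDeriv_const_smul_apply (hs j).contDiffAt)
  rw [e, Finset.sum_mul, Finset.sum_div]
  refine (norm_sum_le _ _).trans (Finset.sum_le_sum (fun j _ => ?_))
  rw [norm_smul, Real.norm_eq_abs, mul_assoc, mul_div_assoc]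
  gcongr
  refine (h _ (by positivity) G M hG hM x).trans ?_
  gcongr
  nlinarith [Nat.cast_nonneg (α := ℝ) j]

lemma TT_sub (φ : E → ℝ) (hφ : ContDiff ℝ (⊤ : ℕ∞) φ) (hc : HasCompactSupport φ) (N : ℕ)
    (l : ℝ) (G G' : E → ℝ) (hG : Continuous G) (hG' : Continuous G') (x : E) :
    TT φ N l (fun z => G z - G' z) x = TT φ N l G x - TT φ N l G' x := by
  simp only [TT]
  rw [← Finset.sum_sub_distrib]
  refine Finset.sum_congr rfl (fun k _ => ?_)
  rw [← mul_sub, SS, SS, SS, ← integral_sub (SS_integrable φ hφ.continuous hc _ G hG x)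
    (SS_integrable φ hφ.continuous hc _ G' hG' x)]
  simp only [mul_sub]

lemma TT_comm (φ : E → ℝ) (hφ : ContDiff ℝ (⊤ : ℕ∞) φ) (hc : HasCompactSupport φ) (N : ℕ)
    (l l' : ℝ) (hl : 0 < l) (hl' : 0 < l') (G : E → ℝ) (hG : Continuous G) (x : E) :
    TT φ N l (TT φ N l' G) x = TT φ N l' (TT φ N l G) x := by
  have h : ∀ l' : ℝ, 0 < l' → ∀ l, TT φ N l (TT φ N l' G) x = ∑ k ∈ Finset.range N,
      ∑ j ∈ Finset.range N, cc N k * (cc N j * SS φ ((k + 1) * l) (SS φ ((j + 1) * l') G) x) := by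
    intro l' hl' l
    rw [TT]
    refine Finset.sum_congr rfl (fun k _ => ?_)
    rw [← Finset.mul_sum]
    congr 1
    exact SS_sum φ hφ.continuous hc _ _ _ (fun (j : ℕ) => SS φ ((j + 1) * l') G)
      (fun j => (SS_contDiff φ hφ hc _ (by positivity) G hG).1.continuous) x
  rw [h l' hl' l, h l hl l', Finset.sum_comm]
  refine Finset.sum_congr rfl (fun k _ => Finset.sum_congr rfl (fun j _ => ?_))
  rw [SS_comm φ hφ.continuous hc _ _ G hG]
  ring

lemma TT_approx (φ : E → ℝ) (hφ : ContDiff ℝ (⊤ : ℕ∞) φ) (hc : HasCompactSupport φ)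
    (hnn : ∀ y, 0 ≤ φ y) (hintg : ∫ y, φ y = 1) (hsupp : ∀ y, φ y ≠ 0 → ‖y‖ ≤ 1)
    (N n : ℕ) (F : E → ℝ) (hF : Continuous F) (C : ℝ) (hC : 0 ≤ C)
    (hdiff : ∀ x v, |(fwdDiff v)^[N] F x| ≤ C * ‖v‖ ^ n) (l : ℝ) (hl : 0 < l) (x : E) :
    |F x - TT φ N l F x| ≤ C * l ^ n := by
  have hφi : Integrable φ := hφ.continuous.integrable_of_hasCompactSupport hc
  have e : F x - TT φ N l F x = ∫ y, φ y * ((-1) ^ N * (fwdDiff (-(l • y)))^[N] F x) := by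
    have e1 : F x = ∫ y, φ y * F x := by rw [integral_mul_const, hintg, one_mul]
    have e2 : TT φ N l F x = ∫ y, ∑ k ∈ Finset.range N, cc N k * (φ y * F (x - ((k + 1) * l) • y)) := by
      rw [integral_finsetSum _ (fun k _ =>
        (SS_integrable φ hφ.continuous hc _ F hF x).const_mul _)]
      simp only [TT, SS, integral_const_mul]
    rw [e2]
    nth_rewrite 1 [e1]
    rw [← integral_sub (hφi.mul_const _) (integrable_finsetSum _ (fun k _ =>
        (SS_integrable φ hφ.continuous hc _ F hF x).const_mul _))]
    congr 1
    ext y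
    rw [fwdDiff_iter_eq_sum_shift, Finset.sum_range_succ']
    have hsq : ((-1:ℝ) ^ N) * (-1) ^ N = 1 := by rw [← mul_pow]; norm_num
    have : ∀ k : ℕ, x + (k + 1) • -(l • y) = x - (((k:ℝ) + 1) * l) • y := by
      intro k
      rw [smul_neg, ← sub_eq_add_neg, mul_smul, ← Nat.cast_smul_eq_nsmul ℝ]
      push_cast; rfl
    simp only [this, zsmul_eq_mul]
    push_cast
    simp only [Nat.sub_zero, Nat.choose_zero_right, Nat.cast_one, mul_one, zero_smul, add_zero]
    rw [mul_add, mul_add, ← mul_assoc ((-1:ℝ) ^ N) ((-1:ℝ) ^ N), hsq, one_mul, add_comm,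
      sub_eq_add_neg, ← Finset.sum_neg_distrib, Finset.mul_sum, Finset.mul_sum]
    congr 1
    refine Finset.sum_congr rfl (fun k _ => ?_)
    rw [cc]; ring
  rw [e, ← Real.norm_eq_abs]
  have : C * l ^ n = ∫ y, φ y * (C * l ^ n) := by rw [integral_mul_const, hintg, one_mul]
  rw [this]
  refine norm_integral_le_of_norm_le (hφi.mul_const _) (Filter.Eventually.of_forall (fun y => ?_))
  by_cases hy : φ y = 0
  · simp [hy]
  rw [norm_mul, norm_mul, Real.norm_of_nonneg (hnn y), norm_pow, norm_neg, norm_one, one_pow, one_mul]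
  refine mul_le_mul_of_nonneg_left ?_ (hnn y)
  refine (hdiff x _).trans ?_
  gcongr
  rw [norm_neg, norm_smul, Real.norm_of_nonneg hl.le]
  exact mul_le_of_le_one_right hl.le (hsupp y hy)

end ZyConv
section ZyLP
open MeasureTheory
variable {E : Type} [NormedAddCommGroup E] [InnerProductSpace ℝ E] [FiniteDimensional ℝ E]
  [MeasurableSpace E] [BorelSpace E]

lemma zy_second_diff (G : E → ℝ) (hG : ContDiff ℝ (⊤ : ℕ∞) G) (m : ℕ) (B : ℝ)
    (hB : ∀ x, ‖iteratedFDeriv ℝ (m + 2) G x‖ ≤ B) (x h : E) :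
    ‖iteratedFDeriv ℝ m G (x + h) - (2 : ℝ) • iteratedFDeriv ℝ m G x
      + iteratedFDeriv ℝ m G (x - h)‖ ≤ B * ‖h‖ ^ 2 := by
  have hd : ∀ n : ℕ, Differentiable ℝ (iteratedFDeriv ℝ n G) := fun n =>
    hG.differentiable_iteratedFDeriv (by exact_mod_cast WithTop.coe_lt_top n)
  have l1 : ∀ y z, ‖iteratedFDeriv ℝ (m + 1) G y - iteratedFDeriv ℝ (m + 1) G z‖ ≤ B * ‖y - z‖ := by
    intro y z
    refine convex_univ.norm_image_sub_le_of_norm_fderiv_le (fun w _ => (hd _) w) (fun w _ => ?_)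
      (Set.mem_univ z) (Set.mem_univ y)
    rw [norm_fderiv_iteratedFDeriv]; exact hB w
  have l2 : ∀ y z, ‖fderiv ℝ (iteratedFDeriv ℝ m G) y - fderiv ℝ (iteratedFDeriv ℝ m G) z‖
      ≤ B * ‖y - z‖ := by
    intro y z
    refine le_trans (le_of_eq ?_) (l1 y z)
    rw [fderiv_iteratedFDeriv, Function.comp_apply, Function.comp_apply]
    exact (dist_eq_norm _ _).symm.trans
      (((continuousMultilinearCurryLeftEquiv ℝ (fun _ : Fin (m + 1) => E) ℝ).dist_map _ _).trans
        (dist_eq_norm _ _))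
  have e : iteratedFDeriv ℝ m G (x + h) - (2 : ℝ) • iteratedFDeriv ℝ m G x
      + iteratedFDeriv ℝ m G (x - h) =
      (fun y => iteratedFDeriv ℝ m G (y + h) - iteratedFDeriv ℝ m G y) x -
      (fun y => iteratedFDeriv ℝ m G (y + h) - iteratedFDeriv ℝ m G y) (x - h) := by
    simp only [sub_add_cancel, two_smul]; abel
  rw [e]
  have h1 := hd m
  refine (convex_univ.norm_image_sub_le_of_norm_fderiv_le (𝕜 := ℝ) (C := B * ‖h‖)
    (f := fun y => iteratedFDeriv ℝ m G (y + h) - iteratedFDeriv ℝ m G y)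
    (fun w _ => by fun_prop) (fun w _ => ?_)
      (Set.mem_univ (x - h)) (Set.mem_univ x)).trans (le_of_eq ?_)
  · rw [fderiv_fun_sub (by fun_prop) (by fun_prop), fderiv_comp_add_right]
    refine (l2 _ _).trans (le_of_eq ?_)
    congr 2; abel
  · rw [sub_sub_cancel]; ring

lemma zy_decomp (m : ℕ) (F : E → ℝ) (hF : Continuous F) (M : ℝ) (hM : ∀ x, |F x| ≤ M)
    (C : ℝ) (hC : 0 ≤ C) (hdiff : ∀ x v, |(fwdDiff v)^[m + 2] F x| ≤ C * ‖v‖ ^ (m + 1)) :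
    ∃ G : ℕ → E → ℝ, (∀ j, ContDiff ℝ (⊤ : ℕ∞) (G j)) ∧
      (∀ k : ℕ, ∃ B : ℝ, 0 ≤ B ∧ ∀ j x, ‖iteratedFDeriv ℝ k (G j) x‖ ≤
        B * (((1 / 2 : ℝ) ^ j) ^ (m + 1) / ((1 / 2 : ℝ) ^ j) ^ k)) ∧
      ∀ x, Filter.Tendsto (fun n => ∑ j ∈ Finset.range n, G j x) Filter.atTop (nhds (F x)) := by
  have hM0 : 0 ≤ M := (abs_nonneg _).trans (hM 0)
  let b : ContDiffBump (0 : E) := ⟨1 / 2, 1, by norm_num, by norm_num⟩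
  obtain ⟨φ, hφ, hc, hnn, hintg, hsupp⟩ : ∃ φ : E → ℝ, ContDiff ℝ (⊤ : ℕ∞) φ ∧ HasCompactSupport φ ∧
      (∀ y, 0 ≤ φ y) ∧ (∫ y, φ y = 1) ∧ (∀ y, φ y ≠ 0 → ‖y‖ ≤ 1) := by
    refine ⟨b.normed volume, b.contDiff_normed, b.hasCompactSupport_normed, b.nonneg_normed,
      b.integral_normed, fun y hy => ?_⟩
    have : y ∈ Function.support (b.normed volume) := hy
    rw [b.support_normed_eq] at this
    exact (mem_ball_zero_iff.1 this).le
  set T : ℝ → (E → ℝ) → E → ℝ := TT φ (m + 2) with hT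
  set r : ℕ → ℝ := fun j => (1 / 2 : ℝ) ^ j with hr
  have hr0 : ∀ j, 0 < r j := fun j => by positivity
  have hTs : ∀ l, 0 < l → ∀ G, Continuous G → ContDiff ℝ (⊤ : ℕ∞) (T l G) :=
    fun l hl G hG => TT_contDiff φ hφ hc _ l hl G hG
  have hTc : ∀ l, 0 < l → ∀ G, Continuous G → Continuous (T l G) :=
    fun l hl G hG => (hTs l hl G hG).continuous
  have hTsub : ∀ l G G', Continuous G → Continuous G' → ∀ x,
    T l (fun z => G z - G' z) x = T l G x - T l G' x := fun l G G' h h' x =>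
      TT_sub φ hφ hc _ l G G' h h' x
  have hTcomm : ∀ l l', 0 < l → 0 < l' → ∀ x, T l (T l' F) x = T l' (T l F) x := fun l l' hl hl' x =>
    TT_comm φ hφ hc _ l l' hl hl' F hF x
  have hTap : ∀ l, 0 < l → ∀ x, |F x - T l F x| ≤ C * l ^ (m + 1) := fun l hl x =>
    TT_approx φ hφ hc hnn hintg hsupp _ _ F hF C hC hdiff l hl x
  have hTb := TT_bound φ hφ hc (m + 2)
  obtain ⟨A0, hA0, hTb0⟩ := hTb 0
  have hTb0' : ∀ (l : ℝ), 0 < l → ∀ (G : E → ℝ) (M : ℝ), Continuous G → (∀ x, |G x| ≤ M) →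
      ∀ x, |T l G x| ≤ A0 * M := by
    intro l hl G M hG hM x
    have := hTb0 l hl G M hG hM x
    simpa using this
  set H : ℕ → E → ℝ := fun n => T (r n) (T (r n) F) with hH
  have hHs : ∀ n, ContDiff ℝ (⊤ : ℕ∞) (H n) := fun n => hTs _ (hr0 n) _ (hTc _ (hr0 n) F hF)
  set D : ℕ → E → ℝ := fun j z => T (r (j + 1)) F z - T (r j) F z with hD
  have hDc : ∀ j, Continuous (D j) := fun j =>
    (hTc _ (hr0 _) F hF).sub (hTc _ (hr0 _) F hF)
  have hr1 : ∀ j, r (j + 1) ≤ r j := fun j =>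
    pow_le_pow_of_le_one (by norm_num) (by norm_num) (Nat.le_succ j)
  have hDb : ∀ j x, |D j x| ≤ 2 * C * r j ^ (m + 1) := by
    intro j x
    have e1 := hTap (r (j + 1)) (hr0 _) x
    have e2 := hTap (r j) (hr0 _) x
    have e3 : C * r (j + 1) ^ (m + 1) ≤ C * r j ^ (m + 1) := by
      have := hr1 j
      have := (hr0 (j + 1)).le
      gcongr
    rw [abs_le] at e1 e2 ⊢
    simp only [hD]
    constructor <;> linarith [e1.1, e1.2, e2.1, e2.2]
  have hHd : ∀ j, (fun x => H (j + 1) x - H j x) =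
      T (r (j + 1)) (D j) + T (r j) (D j) := by
    intro j
    ext x
    simp only [hH, hD, Pi.add_apply]
    rw [hTsub _ _ _ (hTc _ (hr0 _) F hF) (hTc _ (hr0 _) F hF),
      hTsub _ _ _ (hTc _ (hr0 _) F hF) (hTc _ (hr0 _) F hF), hTcomm (r j) (r (j + 1)) (hr0 _) (hr0 _)]
    ring
  refine ⟨fun j => Nat.casesOn j (H 0) (fun i => fun x => H (i + 1) x - H i x), ?_, ?_, ?_⟩
  · intro j
    cases j with
    | zero => exact hHs 0
    | succ i => exact (hHs (i + 1)).sub (hHs i)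
  · intro k
    obtain ⟨A, hA, hb⟩ := hTb k
    refine ⟨A * (A0 * M) + 4 * A * C * 2 ^ (m + 1), by positivity, fun j x => ?_⟩
    cases j with
    | zero =>
      have := hb 1 one_pos (T (r 0) F) (A0 * M) (hTc _ (hr0 _) F hF)
        (hTb0' _ (hr0 _) F M hF hM) x
      have hp : 0 ≤ 4 * A * C * 2 ^ (m + 1) := by positivity
      simp only [pow_zero, one_pow, div_one, mul_one] at this ⊢
      refine le_trans (le_of_eq ?_) (this.trans (by linarith))
      simp [hH, hr, hT]
    | succ i =>
      have q1 := hb (r (i + 1)) (hr0 _) (D i) _ (hDc i) (hDb i) x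
      have q2 := hb (r i) (hr0 _) (D i) _ (hDc i) (hDb i) x
      have q3 : A * (2 * C * r i ^ (m + 1)) / r i ^ k ≤
          A * (2 * C * r i ^ (m + 1)) / r (i + 1) ^ k := by
        have := hr1 i
        have := hr0 (i + 1)
        have := hr0 i
        gcongr
      have e : r i = 2 * r (i + 1) := by simp only [hr]; rw [pow_succ]; ring
      change ‖iteratedFDeriv ℝ k (fun x => H (i + 1) x - H i x) x‖ ≤ _ * (r (i + 1) ^ (m + 1) / r (i + 1) ^ k)
      rw [hHd, iteratedFDeriv_add_apply
        ((hTs _ (hr0 _) _ (hDc i)).of_le (by exact_mod_cast le_top)).contDiffAt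
        ((hTs _ (hr0 _) _ (hDc i)).of_le (by exact_mod_cast le_top)).contDiffAt]
      refine (norm_add_le _ _).trans ((add_le_add q1 (q2.trans q3)).trans ?_)
      have hp : 0 ≤ A * (A0 * M) * (r (i + 1) ^ (m + 1) / r (i + 1) ^ k) := by
        have := hr0 (i + 1)
        positivity
      rw [e, mul_pow]
      refine le_trans (le_of_eq ?_) (le_add_of_nonneg_left hp) |>.trans (le_of_eq (add_mul _ _ _).symm)
      ring
  · intro x
    have e : ∀ n, ∑ j ∈ Finset.range (n + 1),
        (Nat.casesOn (motive := fun _ => E → ℝ) j (H 0) (fun i => fun x => H (i + 1) x - H i x)) x = H n x := by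
      intro n
      induction n with
      | zero => simp
      | succ n ih => rw [Finset.sum_range_succ, ih]; simp
    rw [← Filter.tendsto_add_atTop_iff_nat 1]
    simp only [e]
    have hlim : Filter.Tendsto (fun n => (C + A0 * C) * r n ^ (m + 1)) Filter.atTop (nhds 0) := by
      have h1 : Filter.Tendsto r Filter.atTop (nhds 0) :=
        tendsto_pow_atTop_nhds_zero_of_lt_one (by norm_num) (by norm_num)
      have := (h1.pow (m + 1)).const_mul (C + A0 * C)
      simpa using this
    rw [tendsto_iff_norm_sub_tendsto_zero]
    refine squeeze_zero (fun _ => norm_nonneg _) (fun n => ?_) hlim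
    have a1 := hTap (r n) (hr0 n) x
    have a2 := hTb0' (r n) (hr0 n) (fun z => F z - T (r n) F z) _ (hF.sub (hTc _ (hr0 _) F hF))
      (hTap (r n) (hr0 n)) x
    rw [hTsub _ _ _ hF (hTc _ (hr0 _) F hF)] at a2
    rw [Real.norm_eq_abs]
    rw [abs_le] at a1 a2 ⊢
    simp only [hH]
    constructor <;> nlinarith [a1.1, a1.2, a2.1, a2.2]

theorem zy_analysis (m : ℕ) (F : E → ℝ) (hF : Continuous F) (M : ℝ) (hM : ∀ x, |F x| ≤ M)
    (C : ℝ) (hC : 0 ≤ C) (hdiff : ∀ x v, |(fwdDiff v)^[m + 2] F x| ≤ C * ‖v‖ ^ (m + 1)) :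
    ContDiff ℝ m F ∧ ∃ C' : ℝ, ∀ x h : E, ‖h‖ ≤ 1 →
      ‖iteratedFDeriv ℝ m F (x + h) - (2 : ℝ) • iteratedFDeriv ℝ m F x
      + iteratedFDeriv ℝ m F (x - h)‖ ≤ C' * ‖h‖ := by
  -- decomposition
  obtain ⟨G, hGs, hGb, hGsum⟩ : ∃ G : ℕ → E → ℝ, (∀ j, ContDiff ℝ (⊤ : ℕ∞) (G j)) ∧
      (∀ k : ℕ, ∃ B : ℝ, 0 ≤ B ∧ ∀ j x, ‖iteratedFDeriv ℝ k (G j) x‖ ≤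
        B * (((1 / 2 : ℝ) ^ j) ^ (m + 1) / ((1 / 2 : ℝ) ^ j) ^ k)) ∧
      ∀ x, Filter.Tendsto (fun n => ∑ j ∈ Finset.range n, G j x) Filter.atTop (nhds (F x)) := by
    exact zy_decomp m F hF M hM C hC hdiff
  have hM0 : 0 ≤ M := (abs_nonneg _).trans (hM 0)
  have hb : ∀ k ≤ m, ∃ B : ℝ, 0 ≤ B ∧ ∀ j x, ‖iteratedFDeriv ℝ k (G j) x‖ ≤ B * (1 / 2 : ℝ) ^ j := by
    intro k hk
    obtain ⟨B, hB, h⟩ := hGb k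
    refine ⟨B, hB, fun j x => (h j x).trans ?_⟩
    gcongr
    have hp : (0:ℝ) < (1 / 2) ^ j := by positivity
    have h1 : ((1:ℝ) / 2) ^ j ≤ 1 := pow_le_one₀ (by norm_num) (by norm_num)
    rw [div_le_iff₀ (by positivity), ← pow_succ']
    exact pow_le_pow_of_le_one hp.le h1 (by omega)
  have hgeo : Summable (fun j : ℕ => (1 / 2 : ℝ) ^ j) := summable_geometric_two
  choose! B hB0 hB using hb
  have hFt : F = fun x => ∑' j, G j x := by
    ext x
    have hs : Summable (fun j => G j x) := by
      refine Summable.of_norm_bounded (hgeo.mul_left (B 0)) (fun j => ?_)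
      have := hB 0 (Nat.zero_le _) j x
      rwa [norm_iteratedFDeriv_zero] at this
    exact tendsto_nhds_unique (hGsum x) hs.hasSum.tendsto_sum_nat
  have hcd : ContDiff ℝ m F := by
    rw [hFt]
    refine contDiff_tsum (N := (m : ℕ∞)) (v := fun k j => B k * (1 / 2 : ℝ) ^ j)
      (fun j => (hGs j).of_le (by exact_mod_cast le_top)) (fun k _ => hgeo.mul_left _) ?_
    intro k j x hk
    exact hB k (by exact_mod_cast hk) j x
  refine ⟨hcd, ?_⟩
  have hD : ∀ x, iteratedFDeriv ℝ m F x = ∑' j, iteratedFDeriv ℝ m (G j) x := by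
    intro x
    rw [hFt]
    exact iteratedFDeriv_tsum_apply (N := (m : ℕ∞)) (v := fun k j => B k * (1 / 2 : ℝ) ^ j)
      (fun j => (hGs j).of_le (by exact_mod_cast le_top)) (fun k _ => hgeo.mul_left _)
      (fun k j x hk => hB k (by exact_mod_cast hk) j x) le_rfl x
  have hDs : ∀ x, Summable (fun j => iteratedFDeriv ℝ m (G j) x) := fun x =>
    Summable.of_norm_bounded (hgeo.mul_left (B m)) (fun j => hB m le_rfl j x)
  obtain ⟨B2, hB20, hB2⟩ := hGb (m + 2)
  refine ⟨2 * B2 + 8 * B m, fun x h hh => ?_⟩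
  by_cases h0 : h = 0
  · subst h0; simp [two_smul]
  have hpos : 0 < ‖h‖ := norm_pos_iff.2 h0
  set T : ℕ → (E [×m]→L[ℝ] ℝ) := fun j => iteratedFDeriv ℝ m (G j) (x + h)
    - (2 : ℝ) • iteratedFDeriv ℝ m (G j) x + iteratedFDeriv ℝ m (G j) (x - h) with hT
  have hTs : Summable T := ((hDs _).sub ((hDs _).const_smul _)).add (hDs _)
  have hTt : iteratedFDeriv ℝ m F (x + h) - (2 : ℝ) • iteratedFDeriv ℝ m F x
      + iteratedFDeriv ℝ m F (x - h) = ∑' j, T j := by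
    rw [hD, hD, hD, ← Summable.tsum_const_smul _ (hDs x), ← Summable.tsum_sub (hDs _) ((hDs _).const_smul _),
      ← Summable.tsum_add ((hDs _).sub ((hDs _).const_smul _)) (hDs _)]
  have hT1 : ∀ j, ‖T j‖ ≤ 4 * B m * (1 / 2 : ℝ) ^ j := by
    intro j
    have e1 := hB m le_rfl j (x + h)
    have e2 := hB m le_rfl j x
    have e3 := hB m le_rfl j (x - h)
    calc ‖T j‖ ≤ ‖iteratedFDeriv ℝ m (G j) (x + h) - (2 : ℝ) • iteratedFDeriv ℝ m (G j) x‖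
        + ‖iteratedFDeriv ℝ m (G j) (x - h)‖ := norm_add_le _ _
      _ ≤ (‖iteratedFDeriv ℝ m (G j) (x + h)‖ + ‖(2 : ℝ) • iteratedFDeriv ℝ m (G j) x‖)
        + ‖iteratedFDeriv ℝ m (G j) (x - h)‖ := by gcongr; exact norm_sub_le _ _
      _ ≤ _ := by
        rw [norm_smul]; norm_num at e1 e2 e3 ⊢; linarith
  have hT2 : ∀ j, ‖T j‖ ≤ B2 * ‖h‖ ^ 2 * 2 ^ j := by
    intro j
    refine (zy_second_diff (G j) (hGs j) m (B2 * 2 ^ j) (fun y => (hB2 j y).trans (le_of_eq ?_))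
      x h).trans (le_of_eq (by ring))
    congr 1
    rw [pow_succ _ (m + 1), div_mul_eq_div_div, div_self (by positivity), one_div, ← inv_pow]
    norm_num
  obtain ⟨J, hJ1, hJ2⟩ := exists_nat_pow_near_of_lt_one hpos hh (by norm_num : (0:ℝ) < 1 / 2)
    (by norm_num)
  rw [hTt, ← hTs.sum_add_tsum_nat_add (J + 1)]
  have p1 : ‖∑ j ∈ Finset.range (J + 1), T j‖ ≤ 2 * B2 * ‖h‖ := by
    calc _ ≤ ∑ j ∈ Finset.range (J + 1), B2 * ‖h‖ ^ 2 * 2 ^ j :=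
          (norm_sum_le _ _).trans (Finset.sum_le_sum (fun j _ => hT2 j))
      _ = B2 * ‖h‖ ^ 2 * (2 ^ (J + 1) - 1) := by
        rw [← Finset.mul_sum, geom_sum_eq (by norm_num)]; norm_num
      _ ≤ B2 * ‖h‖ ^ 2 * 2 ^ (J + 1) := by gcongr; linarith
      _ = 2 * B2 * ‖h‖ * (‖h‖ * 2 ^ J) := by ring
      _ ≤ 2 * B2 * ‖h‖ * ((1 / 2) ^ J * 2 ^ J) := by gcongr
      _ = _ := by rw [← mul_pow]; norm_num
  have p2 : ‖∑' j, T (j + (J + 1))‖ ≤ 8 * B m * ‖h‖ := by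
    have hBm := hB0 m le_rfl
    have hsum : HasSum (fun j : ℕ => 4 * B m * (1 / 2 : ℝ) ^ (J + 1) * (1 / 2 : ℝ) ^ j)
        (4 * B m * (1 / 2 : ℝ) ^ (J + 1) * 2) := hasSum_geometric_two.mul_left _
    refine (tsum_of_norm_bounded hsum (fun j => (hT1 _).trans (le_of_eq ?_))).trans ?_
    · rw [pow_add _ j]; ring
    · nlinarith
  calc _ ≤ _ := norm_add_le _ _
    _ ≤ _ := by rw [add_mul]; exact add_le_add p1 p2

end ZyLP

section ZyPd
variable {d : ℕ}

/-- iterated partial derivative along a list of directions -/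
noncomputable def pdList (l : List (Fin d)) (f : EuclideanSpace ℝ (Fin d) → ℝ) :
    EuclideanSpace ℝ (Fin d) → ℝ := l.foldr (fun i g => pd d i g) f

lemma pdList_nil (f : EuclideanSpace ℝ (Fin d) → ℝ) : pdList [] f = f := rfl

lemma pdList_cons (i : Fin d) (l : List (Fin d)) (f : EuclideanSpace ℝ (Fin d) → ℝ) :
    pdList (i :: l) f = pd d i (pdList l f) := rfl

lemma pdList_append (l l' : List (Fin d)) (f : EuclideanSpace ℝ (Fin d) → ℝ) :
    pdList (l ++ l') f = pdList l (pdList l' f) := by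
  simp [pdList, List.foldr_append]

lemma pdList_replicate (n : ℕ) (i : Fin d) (f : EuclideanSpace ℝ (Fin d) → ℝ) :
    pdList (List.replicate n i) f = (pd d i)^[n] f := by
  induction n with
  | zero => rfl
  | succ n ih => rw [List.replicate_succ, pdList_cons, ih, Function.iterate_succ_apply']

/-- the word attached to a multi-index -/
def zyWord (γ : Fin d → ℕ) : List (Fin d) :=
  (List.finRange d).flatMap (fun i => List.replicate (γ i) i)

lemma pdMulti_eq (γ : Fin d → ℕ) (f : EuclideanSpace ℝ (Fin d) → ℝ) :
    pdMulti d γ f = pdList (zyWord γ) f := by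
  rw [pdMulti, zyWord]
  induction List.finRange d with
  | nil => rfl
  | cons i L ih =>
    rw [List.foldr_cons, ih, List.flatMap_cons, pdList_append, pdList_replicate]

lemma zyWord_length (γ : Fin d → ℕ) : (zyWord γ).length = ∑ i, γ i := by
  rw [zyWord, List.length_flatMap]
  simp [Fin.sum_univ_def]

lemma zyWord_perm (l : List (Fin d)) : l.Perm (zyWord (fun i => l.count i)) := by
  rw [List.perm_iff_count]
  intro i
  rw [zyWord, List.count_flatMap]
  have : (List.map (List.count i ∘ fun j => List.replicate (l.count j) j) (List.finRange d)).sum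
      = ∑ j, (if j = i then l.count j else 0) := by
    rw [Fin.sum_univ_def]
    congr 1
    refine List.map_congr_left (fun j _ => ?_)
    simp [List.count_replicate]
  rw [this]
  simp

lemma pd_congr {U : Set (EuclideanSpace ℝ (Fin d))} (hU : IsOpen U) (i : Fin d)
    {f g : EuclideanSpace ℝ (Fin d) → ℝ} (h : Set.EqOn f g U) : Set.EqOn (pd d i f) (pd d i g) U := by
  intro x hx
  have : f =ᶠ[nhds x] g := Filter.eventuallyEq_of_mem (hU.mem_nhds hx) h
  simp only [pd, this.fderiv_eq]

lemma pdList_congr {U : Set (EuclideanSpace ℝ (Fin d))} (hU : IsOpen U) (l : List (Fin d))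
    {f g : EuclideanSpace ℝ (Fin d) → ℝ} (h : Set.EqOn f g U) :
    Set.EqOn (pdList l f) (pdList l g) U := by
  induction l with
  | nil => exact h
  | cons i l ih => exact pd_congr hU i ih

lemma pd_contDiffOn {U : Set (EuclideanSpace ℝ (Fin d))} (hU : IsOpen U) (i : Fin d) (n : ℕ)
    {f : EuclideanSpace ℝ (Fin d) → ℝ} (h : ContDiffOn ℝ (n + 1 : ℕ) f U) :
    ContDiffOn ℝ n (pd d i f) U :=
  (h.fderiv_of_isOpen hU (m := n) (by norm_cast)).clm_apply contDiffOn_const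

lemma pdList_contDiffOn {U : Set (EuclideanSpace ℝ (Fin d))} (hU : IsOpen U) (l : List (Fin d))
    {f : EuclideanSpace ℝ (Fin d) → ℝ} : ∀ n : ℕ, ContDiffOn ℝ (n + l.length : ℕ) f U →
    ContDiffOn ℝ n (pdList l f) U := by
  induction l with
  | nil => intro n h; exact h
  | cons i l ih =>
    intro n h
    refine pd_contDiffOn hU i n (ih (n + 1) ?_)
    refine h.of_le ?_
    rw [List.length_cons]
    norm_cast
    omega

lemma pd_comm {U : Set (EuclideanSpace ℝ (Fin d))} (hU : IsOpen U) (i j : Fin d)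
    {f : EuclideanSpace ℝ (Fin d) → ℝ} (h : ContDiffOn ℝ (2 : ℕ) f U) :
    Set.EqOn (pd d i (pd d j f)) (pd d j (pd d i f)) U := by
  intro x hx
  have hf : ContDiffAt ℝ (2 : ℕ) f x := h.contDiffAt (hU.mem_nhds hx)
  have hdd : DifferentiableAt ℝ (fderiv ℝ f) x :=
    (hf.fderiv_right (m := 1) (by norm_num)).differentiableAt (by norm_num)
  have hs : IsSymmSndFDerivAt ℝ f x := hf.isSymmSndFDerivAt (by simp)
  have e : ∀ k : Fin d, fderiv ℝ (pd d k f) x =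
      (fderiv ℝ (fderiv ℝ f) x).flip (EuclideanSpace.single k 1) := by
    intro k
    have := (hdd.hasFDerivAt.clm_apply (hasFDerivAt_const (EuclideanSpace.single k (1:ℝ)) x)).fderiv
    refine this.trans ?_
    ext v; simp
  have ei : ∀ i k : Fin d, pd d i (pd d k f) x =
      fderiv ℝ (fderiv ℝ f) x (EuclideanSpace.single i 1) (EuclideanSpace.single k 1) := by
    intro i k
    change fderiv ℝ (pd d k f) x (EuclideanSpace.single i 1) = _
    rw [e]; rfl
  rw [ei, ei]
  exact hs.eq _ _

lemma pdList_perm {U : Set (EuclideanSpace ℝ (Fin d))} (hU : IsOpen U) {l l' : List (Fin d)}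
    (hp : l.Perm l') {f : EuclideanSpace ℝ (Fin d) → ℝ} (h : ContDiffOn ℝ (l.length : ℕ) f U) :
    Set.EqOn (pdList l f) (pdList l' f) U := by
  induction hp with
  | nil => exact fun _ _ => rfl
  | cons i hp ih =>
    refine pd_congr hU i (ih (h.of_le ?_))
    rw [List.length_cons]; norm_cast; omega
  | swap i j l =>
    refine pd_comm hU j i (pdList_contDiffOn hU l 2 (h.of_le ?_))
    rw [List.length_cons, List.length_cons]; norm_cast; omega
  | trans h1 h2 ih1 ih2 =>
    refine (ih1 h).trans (ih2 ?_)
    rwa [← h1.length_eq]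

lemma pdList_eq_iteratedFDeriv (l : List (Fin d)) {F : EuclideanSpace ℝ (Fin d) → ℝ}
    (h : ContDiff ℝ (l.length : ℕ) F) (x : EuclideanSpace ℝ (Fin d)) :
    pdList l F x = iteratedFDeriv ℝ l.length F x (fun k => EuclideanSpace.single (l.get k) 1) := by
  induction l generalizing x with
  | nil => simp [pdList_nil]
  | cons i l ih =>
    have h' : ContDiff ℝ (l.length : ℕ) F := h.of_le (by rw [List.length_cons]; norm_cast; omega)
    have e : pdList l F = fun y => iteratedFDeriv ℝ l.length F y
        (fun k => EuclideanSpace.single (l.get k) 1) := funext (ih h')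
    have hdf : DifferentiableAt ℝ (iteratedFDeriv ℝ l.length F) x :=
      h.differentiable_iteratedFDeriv (by rw [List.length_cons]; norm_cast; omega) x
    rw [pdList_cons, pd, e, fderiv_continuousMultilinear_apply_const_apply hdf]
    simp only [List.length_cons]
    rw [iteratedFDeriv_succ_apply_left]
    rfl

end ZyPd

section ZyComp

lemma zy_holder {V : Type*} [NormedAddCommGroup V] [NormedSpace ℝ V] (g : V → ℝ) (a : V)
    (hg : LZ g a) (hc : ContinuousAt g a) :
    ∃ δ > 0, ∃ A : ℝ, 0 ≤ A ∧ ∀ x h, ‖x - a‖ < δ → ‖h‖ < δ → |g (x + h) - g x| ≤ A * √‖h‖ := by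
  obtain ⟨δ1, hδ1, C0, hC0⟩ := hg
  obtain ⟨δ2, hδ2, hb⟩ := Metric.continuousAt_iff.1 hc 1 one_pos
  obtain ⟨D, hD, hD1, hD2⟩ : ∃ D > 0, D ≤ δ1 ∧ D ≤ δ2 :=
    ⟨min δ1 δ2, by positivity, min_le_left _ _, min_le_right _ _⟩
  set C := |C0| with hCdef
  have hCnn : 0 ≤ C := abs_nonneg _
  have hC : ∀ x h, ‖x - a‖ < D → ‖h‖ < D → |g (x + h) - 2 * g x + g (x - h)| ≤ C * ‖h‖ :=
    fun x h hx hh => (hC0 x h (hx.trans_le hD1) (hh.trans_le hD1)).trans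
      (mul_le_mul_of_nonneg_right (le_abs_self _) (norm_nonneg _))
  have hM : ∀ x, ‖x - a‖ < D → |g x - g a| < 1 := fun x hx => by
    have := hb (x := x) (by rw [dist_eq_norm]; exact hx.trans_le hD2)
    rwa [Real.dist_eq] at this
  set A := 2 / √(D / 4) + 2 * C * √D with hA
  have hA0 : 0 ≤ A := by positivity
  refine ⟨D / 2, by positivity, A, hA0, ?_⟩
  have key : ∀ n : ℕ, ∀ x h, ‖x - a‖ < D / 2 → ‖h‖ < D / 2 → D / 4 ≤ 2 ^ n * ‖h‖ →
      |g (x + h) - g x| ≤ A * √‖h‖ := by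
    have base : ∀ x h, ‖x - a‖ < D / 2 → ‖h‖ < D / 2 → D / 4 ≤ ‖h‖ →
      |g (x + h) - g x| ≤ A * √‖h‖ := by
      intro x h hx hh hn
      have n1 : ‖x + h - a‖ < D := by
        calc ‖x + h - a‖ = ‖(x - a) + h‖ := by congr 1; abel
          _ ≤ _ := norm_add_le _ _
          _ < D := by linarith
      have b1 := hM x (by linarith)
      have b2 := hM (x + h) n1
      have b3 : |g (x + h) - g x| ≤ 2 := by
        rw [abs_lt] at b1 b2; rw [abs_le]; constructor <;> linarith [b1.1, b1.2, b2.1, b2.2]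
      have s1 : √(D / 4) ≤ √‖h‖ := Real.sqrt_le_sqrt hn
      have s0 : 0 < √(D / 4) := by positivity
      calc _ ≤ (2:ℝ) := b3
        _ = 2 / √(D / 4) * √(D / 4) := by field_simp
        _ ≤ A * √‖h‖ := by
          gcongr
          rw [hA]
          have : 0 ≤ 2 * C * √D := by positivity
          linarith
    intro n
    induction n with
    | zero => intro x h hx hh hn; exact base x h hx hh (by simpa using hn)
    | succ n ih =>
      intro x h hx hh hn
      by_cases hq : D / 4 ≤ ‖h‖
      · exact base x h hx hh hq
      push Not at hq
      have e2 : ‖h + h‖ = 2 * ‖h‖ := by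
        rw [← two_smul ℝ, norm_smul]; norm_num
      have r1 := ih x (h + h) hx (by rw [e2]; linarith) (by rw [e2]; rw [pow_succ] at hn; linarith)
      have n1 : ‖x + h - a‖ < D := by
        calc ‖x + h - a‖ = ‖(x - a) + h‖ := by congr 1; abel
          _ ≤ _ := norm_add_le _ _
          _ < D := by linarith
      have r2 := hC (x + h) h n1 (by linarith)
      rw [add_sub_cancel_right, add_assoc] at r2
      rw [e2, Real.sqrt_mul (by norm_num)] at r1
      have s2 : √2 ≤ 3 / 2 := by
        rw [Real.sqrt_le_left (by norm_num)]; norm_num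
      have s3 : ‖h‖ = √‖h‖ * √‖h‖ := (Real.mul_self_sqrt (norm_nonneg _)).symm
      have s4 : √‖h‖ ≤ √D := Real.sqrt_le_sqrt (by linarith)
      have s5 : 0 ≤ √‖h‖ := Real.sqrt_nonneg _
      have r3 : A * (√2 * √‖h‖) ≤ A * (3 / 2 * √‖h‖) := by gcongr
      have r4 : C * ‖h‖ ≤ C * √D * √‖h‖ := by
        calc C * ‖h‖ = C * (√‖h‖ * √‖h‖) := by rw [← s3]
          _ ≤ C * (√D * √‖h‖) := by gcongr
          _ = _ := by ring
      have r5 : 2 * (C * √D * √‖h‖) ≤ A * √‖h‖ := by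
        have : 2 * C * √D ≤ A := by
          rw [hA]
          have : 0 ≤ 2 / √(D / 4) := by positivity
          linarith
        calc _ = (2 * C * √D) * √‖h‖ := by ring
          _ ≤ _ := by gcongr
      rw [abs_le] at r1 r2 ⊢
      constructor <;> linarith [r1.1, r1.2, r2.1, r2.2]
  intro x h hx hh
  by_cases h0 : h = 0
  · subst h0; simp
  have hp : 0 < ‖h‖ := norm_pos_iff.2 h0
  obtain ⟨n, hn⟩ := pow_unbounded_of_one_lt (D / 4 / ‖h‖) (by norm_num : (1:ℝ) < 2)
  refine key n x h hx hh ?_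
  rw [div_lt_iff₀ hp] at hn
  exact hn.le

lemma zy_taylor {V : Type*} [NormedAddCommGroup V] [NormedSpace ℝ V] (c : ℝ → V)
    (hc : ContDiff ℝ (⊤ : ℕ∞) c) (t₀ : ℝ) :
    ∃ L : ℝ, 0 ≤ L ∧ ∃ S : ℝ, 0 ≤ S ∧ ∀ t h : ℝ, |t - t₀| < 1 / 2 → |h| < 1 / 2 →
      ‖deriv c t‖ ≤ S ∧ ‖c (t + h) - c t - h • deriv c t‖ ≤ L * h ^ 2 := by
  have hd : ContDiff ℝ 1 (deriv c) := by
    exact (contDiff_infty_iff_deriv.1 hc).2.of_le (by exact_mod_cast le_top)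
  obtain ⟨L, hL, hlip⟩ := zy_lip (deriv c) hd (Set.Icc (t₀ - 1) (t₀ + 1)) isCompact_Icc
  obtain ⟨S, hS⟩ := (isCompact_Icc (a := t₀ - 1) (b := t₀ + 1)).exists_bound_of_continuousOn
    hd.continuous.continuousOn
  refine ⟨L, hL, S, (norm_nonneg _).trans (hS t₀ ⟨by linarith, by linarith⟩), fun t h ht hh => ?_⟩
  rw [abs_lt] at ht
  have hh' := hh
  rw [abs_lt] at hh'
  have htm : t ∈ Set.Icc (t₀ - 1) (t₀ + 1) := ⟨by linarith [ht.1], by linarith [ht.2]⟩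
  refine ⟨hS t htm, ?_⟩
  have hder : ∀ s : ℝ, HasDerivAt (fun s => c (t + s) - s • deriv c t)
      (deriv c (t + s) - deriv c t) s := by
    intro s
    have h1 : HasDerivAt c (deriv c (t + s)) (t + s) :=
      (hc.differentiable (by simp) (t + s)).hasDerivAt
    have h2 := h1.comp_const_add t s
    have h3 := (hasDerivAt_id s).smul_const (deriv c t)
    rw [one_smul] at h3
    exact h2.sub h3
  have := (convex_closedBall (0:ℝ) |h|).norm_image_sub_le_of_norm_hasDerivWithin_le
    (f := fun s => c (t + s) - s • deriv c t) (f' := fun s => deriv c (t + s) - deriv c t)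
    (C := L * |h|) (x := 0) (y := h) (fun s _ => (hder s).hasDerivWithinAt) (fun s hs => ?_)
    (by simp) (by simp)
  · simp only [add_zero, zero_smul, sub_zero] at this
    rw [sub_right_comm]
    refine this.trans (le_of_eq ?_)
    rw [Real.norm_eq_abs, mul_assoc, abs_mul_abs_self]; ring
  · rw [mem_closedBall_zero_iff, Real.norm_eq_abs] at hs
    have hs' := hs
    rw [abs_le] at hs'
    refine (hlip (t + s) ⟨by linarith [hs'.1, ht.1], by linarith [hs'.2, ht.2]⟩ t htm).trans ?_
    rw [add_sub_cancel_left]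
    gcongr

lemma zy_comp {V : Type*} [NormedAddCommGroup V] [NormedSpace ℝ V] (g : V → ℝ) (c : ℝ → V)
    (hc : ContDiff ℝ (⊤ : ℕ∞) c) (t₀ : ℝ) (hg : LZ g (c t₀)) (hgc : ContinuousAt g (c t₀)) :
    LZ (g ∘ c) t₀ := by
  obtain ⟨δ1, hδ1, A, hA, hhol⟩ := zy_holder g _ hg hgc
  obtain ⟨δ2, hδ2, C0, hC0⟩ := hg
  obtain ⟨L, hL, S, hS, htay⟩ := zy_taylor c hc t₀
  obtain ⟨D, hD, hD1, hD2⟩ : ∃ D > 0, D ≤ δ1 ∧ D ≤ δ2 :=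
    ⟨min δ1 δ2, by positivity, min_le_left _ _, min_le_right _ _⟩
  obtain ⟨η1, hη1, hcont⟩ := Metric.continuousAt_iff.1 (hc.continuous.continuousAt (x := t₀))
    (D / 2) (by positivity)
  obtain ⟨η, hη, e1, e2, e3, e4⟩ : ∃ η > 0, η ≤ 1 / 2 ∧ η ≤ η1 ∧ S * η ≤ D / 2 ∧ L * η ≤ D := by
    refine ⟨min (min (1 / 2) η1) (min (D / 2 / (S + 1)) (D / (L + 1))), by positivity,
      (min_le_left _ _).trans (min_le_left _ _), (min_le_left _ _).trans (min_le_right _ _), ?_, ?_⟩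
    · calc S * _ ≤ (S + 1) * (D / 2 / (S + 1)) := by
            gcongr
            · linarith
            · exact (min_le_right _ _).trans (min_le_left _ _)
        _ = D / 2 := by field_simp
    · calc L * _ ≤ (L + 1) * (D / (L + 1)) := by
            gcongr
            · linarith
            · exact (min_le_right _ _).trans (min_le_right _ _)
        _ = D := by field_simp
  refine ⟨η, hη, |C0| * S + 2 * (A * √L), fun t h ht hh => ?_⟩
  rw [Real.norm_eq_abs] at ht hh
  have hp : ‖c t - c t₀‖ < D / 2 := by
    have := hcont (x := t) (by rw [Real.dist_eq]; linarith)
    rwa [dist_eq_norm] at this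
  have one : ∀ s : ℝ, |s| = |h| → ‖s • deriv c t‖ ≤ S * |h| ∧ ‖s • deriv c t‖ < D / 2 ∧
      |g (c (t + s)) - g (c t + s • deriv c t)| ≤ A * √L * |h| := by
    intro s hs
    obtain ⟨h1, h2⟩ := htay t s (by linarith) (by rw [hs]; linarith)
    have q1 : ‖s • deriv c t‖ ≤ S * |h| := by
      rw [norm_smul, Real.norm_eq_abs, hs, mul_comm]; gcongr
    have q2 : ‖s • deriv c t‖ < D / 2 := by
      rcases hS.eq_or_lt with h0 | h0
      · rw [← h0] at q1; linarith
      · have : S * |h| < S * η := by gcongr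
        linarith
    refine ⟨q1, q2, ?_⟩
    have q3 : ‖c (t + s) - c t - s • deriv c t‖ < D := by
      refine h2.trans_lt ?_
      have hs2 : s ^ 2 = |h| * |h| := by rw [← sq_abs, hs]; ring
      rw [hs2]
      rcases hL.eq_or_lt with h0 | h0
      · rw [← h0]; linarith
      · have z1 : |h| * |h| ≤ |h| * 1 := by gcongr; linarith
        have : L * (|h| * |h|) ≤ L * |h| := by gcongr; linarith
        have : L * |h| < L * η := by gcongr
        linarith
    have q4 : ‖c t + s • deriv c t - c t₀‖ < D := by
      calc _ = ‖(c t - c t₀) + s • deriv c t‖ := by congr 1; abel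
        _ ≤ _ := norm_add_le _ _
        _ < D := by linarith
    have := hhol (c t + s • deriv c t) (c (t + s) - c t - s • deriv c t) (q4.trans_le hD1)
      (q3.trans_le hD1)
    rw [show c t + s • deriv c t + (c (t + s) - c t - s • deriv c t) = c (t + s) by abel] at this
    refine this.trans ?_
    rw [mul_assoc]
    gcongr
    calc √‖c (t + s) - c t - s • deriv c t‖ ≤ √(L * s ^ 2) := Real.sqrt_le_sqrt h2
      _ = √L * |h| := by rw [Real.sqrt_mul hL, Real.sqrt_sq_eq_abs, hs]
  obtain ⟨a1, a2, a3⟩ := one h rfl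
  obtain ⟨b1, b2, b3⟩ := one (-h) (abs_neg h)
  have m := hC0 (c t) (h • deriv c t) (by linarith) (by linarith)
  have m' : C0 * ‖h • deriv c t‖ ≤ |C0| * (S * |h|) :=
    mul_le_mul (le_abs_self _) a1 (norm_nonneg _) (abs_nonneg _)
  rw [neg_smul, ← sub_eq_add_neg, ← sub_eq_add_neg] at b3
  simp only [Function.comp_apply, Real.norm_eq_abs]
  rw [abs_le] at m a3 b3 ⊢
  constructor <;> linarith [m.1, m.2, a3.1, a3.2, b3.1, b3.2]

variable {d : ℕ}

/-- auxiliary local form of the class -/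
def ZC (n : ℕ) (f : EuclideanSpace ℝ (Fin d) → ℝ) (U : Set (EuclideanSpace ℝ (Fin d))) : Prop :=
  ContDiffOn ℝ n f U ∧ ∀ l : List (Fin d), l.length = n → ∀ a ∈ U, LZ (pdList l f) a

lemma ZC_of {n : ℕ} {f : EuclideanSpace ℝ (Fin d) → ℝ} {U : Set (EuclideanSpace ℝ (Fin d))}
    (hU : IsOpen U) (h : ZygmundClassOn d n f U) : ZC n f U := by
  refine ⟨h.1, fun l hl a ha => ?_⟩
  have hperm := zyWord_perm l
  obtain ⟨r, hr, hball⟩ := Metric.nhds_basis_closedBall.mem_iff.1 (hU.mem_nhds ha)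
  obtain ⟨C, hC⟩ := h.2 (fun i => l.count i) (by rw [← zyWord_length, ← hperm.length_eq, hl])
    (Metric.closedBall a r) hball (isCompact_closedBall a r)
  have hEq : Set.EqOn (pdList l f) (pdMulti d (fun i => l.count i) f) U := by
    rw [pdMulti_eq]
    exact pdList_perm hU hperm (by rw [hl]; exact h.1)
  refine ⟨r / 2, by positivity, C, fun x k hx hk => ?_⟩
  by_cases k0 : k = 0
  · subst k0; simp; ring_nf
  have m0 : x ∈ Metric.closedBall a r := by rw [mem_closedBall_iff_norm]; linarith
  have m1 : x + k ∈ Metric.closedBall a r := by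
    rw [mem_closedBall_iff_norm, add_sub_right_comm]
    exact (norm_add_le _ _).trans (by linarith)
  have m2 : x - k ∈ Metric.closedBall a r := by
    rw [mem_closedBall_iff_norm, sub_right_comm]
    exact (norm_sub_le _ _).trans (by linarith)
  rw [hEq (hball m0), hEq (hball m1), hEq (hball m2)]
  exact hC x k m0 m1 m2 k0

lemma ZC_pd {n : ℕ} {f : EuclideanSpace ℝ (Fin d) → ℝ} {U : Set (EuclideanSpace ℝ (Fin d))}
    (hU : IsOpen U) (h : ZC (n + 1) f U) (i : Fin d) : ZC n (pd d i f) U := by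
  refine ⟨pd_contDiffOn hU i n h.1, fun l hl a ha => ?_⟩
  have := h.2 (l ++ [i]) (by simp [hl]) a ha
  rwa [pdList_append] at this

lemma ZC_comp {U : Set (EuclideanSpace ℝ (Fin d))} (hU : IsOpen U)
    (c : ℝ → EuclideanSpace ℝ (Fin d)) (hc : ContDiff ℝ (⊤ : ℕ∞) c) (hcU : ∀ t, c t ∈ U) (n : ℕ) :
    ∀ f : EuclideanSpace ℝ (Fin d) → ℝ, ZC n f U → ZygmundClassR n (f ∘ c) := by
  induction n with
  | zero =>
    intro f hf
    have hfc : ∀ t, ContinuousAt f (c t) := fun t =>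
      hf.1.continuousOn.continuousAt (hU.mem_nhds (hcU t))
    have hcont : Continuous (f ∘ c) :=
      continuous_iff_continuousAt.2 (fun t => (hfc t).comp hc.continuous.continuousAt)
    rw [ZR_zero_iff]
    refine ⟨hcont, fun K hK => ?_⟩
    obtain ⟨C, hC⟩ := zy_compact (f ∘ c) K hK hcont.continuousOn
      (fun t _ => zy_comp f c hc t (hf.2 [] rfl (c t) (hcU t)) (hfc t))
    exact ⟨C, fun x h h1 h2 h3 _ => hC x h h1 h2 h3⟩
  | succ n ih =>
    intro f hf
    have hfd : ∀ t, DifferentiableAt ℝ f (c t) := fun t =>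
      (hf.1.contDiffAt (hU.mem_nhds (hcU t))).differentiableAt (by simp)
    have hcd : Differentiable ℝ c := hc.differentiable (by simp)
    rw [ZR_succ_iff]
    refine ⟨fun t => (hfd t).comp t (hcd t), ?_⟩
    have e : deriv (f ∘ c) = fun t => ∑ i, (deriv c t) i * (pd d i f ∘ c) t := by
      ext t
      rw [fderiv_comp_deriv t (hfd t) (hcd t)]
      have : deriv c t = ∑ i, (deriv c t) i • EuclideanSpace.single i (1:ℝ) := by
        ext j
        simp [Pi.single_apply]
      conv_lhs => rw [this]
      simp [pd]
    rw [e]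
    refine ZR_sum n _ _ (fun i => ZR_mul n (fun t => (deriv c t) i) _ ?_ (ih _ (ZC_pd hU hf i)))
    have hd : ContDiff ℝ (⊤ : ℕ∞) (deriv c) := by
      exact (contDiff_infty_iff_deriv.1 hc).2
    fun_prop

end ZyComp

section ZyMain

lemma zy_fwdDiff_bound {V : Type*} [NormedAddCommGroup V] (F : V → ℝ) (M : ℝ)
    (hM : ∀ x, |F x| ≤ M) (v : V) (n : ℕ) : ∀ x, |(fwdDiff v)^[n] F x| ≤ 2 ^ n * M := by
  induction n with
  | zero => intro x; simpa using hM x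
  | succ n ih =>
    intro x
    rw [Function.iterate_succ_apply', fwdDiff]
    have h1 := ih (x + v)
    have h2 := ih x
    refine (abs_sub _ _).trans ?_
    rw [pow_succ]; linarith

variable {d : ℕ}

lemma zy_local (m : ℕ) (U : Set (EuclideanSpace ℝ (Fin d))) (hU : IsOpen U)
    (f : EuclideanSpace ℝ (Fin d) → ℝ)
    (H : ∀ c : ℝ → EuclideanSpace ℝ (Fin d), ContDiff ℝ (⊤ : ℕ∞) c → (∀ t, c t ∈ U) →
        ZygmundClassR m (f ∘ c)) (a : EuclideanSpace ℝ (Fin d)) (ha : a ∈ U) :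
    ContDiffAt ℝ m f a ∧ ∀ l : List (Fin d), l.length = m → LZ (pdList l f) a := by
  have hfc : ∀ z ∈ U, ContinuousAt f z := fun z hz =>
    zy_continuousAt U hU f (fun c hc hcU => (H c hc hcU).1.continuous) z hz
  obtain ⟨r0, hr0, hball0⟩ := Metric.nhds_basis_closedBall.mem_iff.1 (hU.mem_nhds ha)
  obtain ⟨r, hr, hball⟩ : ∃ r > 0, Metric.closedBall a (3 * r) ⊆ U :=
    ⟨r0 / 3, by positivity, by convert hball0 using 2; ring⟩
  let χ : ContDiffBump a := ⟨r, 2 * r, hr, by linarith⟩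
  have hχs : ContDiff ℝ (⊤ : ℕ∞) χ := χ.contDiff
  have hz : ∀ z, 2 * r ≤ ‖z - a‖ → χ z = 0 := fun z h =>
    χ.zero_of_le_dist (by rw [dist_eq_norm]; exact h)
  have ho : ∀ z ∈ Metric.ball a r, χ z = 1 := fun z h =>
    χ.one_of_mem_closedBall (Metric.ball_subset_closedBall h)
  set F : EuclideanSpace ℝ (Fin d) → ℝ := fun z => χ z * f z with hFdef
  have hF0 : ∀ z, 2 * r ≤ ‖z - a‖ → F z = 0 := fun z h => by simp [hFdef, hz z h]
  have hFc : Continuous F := by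
    rw [continuous_iff_continuousAt]
    intro z
    by_cases hzU : z ∈ U
    · exact hχs.continuous.continuousAt.mul (hfc z hzU)
    · have h3 : 2 * r < ‖z - a‖ := by
        by_contra hcon
        push Not at hcon
        exact hzU (hball (by rw [mem_closedBall_iff_norm]; linarith))
      have hev : F =ᶠ[nhds z] fun _ => 0 := by
        have : {w | 2 * r < ‖w - a‖} ∈ nhds z :=
          (isOpen_lt continuous_const (by fun_prop)).mem_nhds h3
        filter_upwards [this] with w hw
        exact hF0 w (le_of_lt hw)
      exact continuousAt_const.congr hev.symm
  have hKc : IsCompact (Metric.closedBall a (3 * r)) := isCompact_closedBall _ _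
  obtain ⟨M, hM⟩ : ∃ M, ∀ x, |F x| ≤ M := by
    obtain ⟨M, hM⟩ := hKc.exists_bound_of_continuousOn hFc.continuousOn
    refine ⟨max M 0, fun x => ?_⟩
    by_cases hx : x ∈ Metric.closedBall a (3 * r)
    · exact (hM x hx).trans (le_max_left _ _)
    · rw [mem_closedBall_iff_norm, not_le] at hx
      rw [hF0 x (by linarith), abs_zero]
      exact le_max_right _ _
  have hM0 : 0 ≤ M := (abs_nonneg _).trans (hM 0)
  have HF : ∀ c : ℝ → EuclideanSpace ℝ (Fin d), ContDiff ℝ (⊤ : ℕ∞) c → (∀ t, c t ∈ U) →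
      ZygmundClassR m (F ∘ c) := fun c hc hcU =>
    ZR_mul m (χ ∘ c) (f ∘ c) (hχs.comp hc) (H c hc hcU)
  obtain ⟨δ, hδ, C, hC, hdiff⟩ := zy_uniform_of_local
    (fun x v => |(fwdDiff v)^[m + 2] F x|) (fun v => ‖v‖ ^ (m + 1)) (fun v => by positivity) _ hKc
    (fun b hb => zy_local_diff U hU F m HF b (hball hb))
  set δ' := min δ (r / (m + 2)) with hδ'
  have hδ'0 : 0 < δ' := by positivity
  set C1 := C + 2 ^ (m + 2) * M / δ' ^ (m + 1) with hC1
  have hglob : ∀ x v, |(fwdDiff v)^[m + 2] F x| ≤ C1 * ‖v‖ ^ (m + 1) := by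
    intro x v
    have t1 : C * ‖v‖ ^ (m + 1) ≤ C1 * ‖v‖ ^ (m + 1) := by
      gcongr
      rw [hC1]
      have : 0 ≤ 2 ^ (m + 2) * M / δ' ^ (m + 1) := by positivity
      linarith
    by_cases hv : ‖v‖ < δ'
    · by_cases hx : x ∈ Metric.closedBall a (3 * r)
      · exact (hdiff x hx v (hv.trans_le (min_le_left _ _))).trans t1
      · rw [mem_closedBall_iff_norm, not_le] at hx
        have : (fwdDiff v)^[m + 2] F x = 0 := by
          rw [fwdDiff_iter_eq_sum_shift]
          refine Finset.sum_eq_zero (fun k hk => ?_)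
          rw [Finset.mem_range] at hk
          rw [hF0, smul_zero]
          have hk' : (k : ℝ) ≤ m + 2 := by
            have : k ≤ m + 2 := by omega
            exact_mod_cast this
          have n1 : ‖k • v‖ ≤ r := by
            rw [← Nat.cast_smul_eq_nsmul ℝ, norm_smul, Real.norm_natCast]
            calc (k : ℝ) * ‖v‖ ≤ (m + 2) * (r / (m + 2)) := by
                  gcongr
                  exact hv.le.trans (min_le_right _ _)
              _ = r := by field_simp
          have n2 : ‖x - a‖ ≤ ‖x + k • v - a‖ + ‖k • v‖ := by
            calc ‖x - a‖ = ‖(x + k • v - a) - k • v‖ := by congr 1; abel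
              _ ≤ _ := norm_sub_le _ _
          linarith
        rw [this, abs_zero]
        exact (by positivity : 0 ≤ C * ‖v‖ ^ (m + 1)).trans t1
    · push Not at hv
      refine (zy_fwdDiff_bound F M hM v (m + 2) x).trans ?_
      calc 2 ^ (m + 2) * M = 2 ^ (m + 2) * M / δ' ^ (m + 1) * δ' ^ (m + 1) := by field_simp
        _ ≤ C1 * ‖v‖ ^ (m + 1) := by
          gcongr
          rw [hC1]; linarith
  obtain ⟨hcd, C', hC'⟩ := zy_analysis m F hFc M hM C1 (by positivity) hglob
  have hEq : Set.EqOn f F (Metric.ball a r) := fun z hz => by simp [hFdef, ho z hz]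
  refine ⟨hcd.contDiffAt.congr_of_eventuallyEq
    (Filter.eventuallyEq_of_mem (Metric.ball_mem_nhds a hr) hEq), fun l hl => ?_⟩
  have hEq' := pdList_congr Metric.isOpen_ball l hEq
  subst hl
  refine ⟨min 1 (r / 2), by positivity, C', fun x h hx hh => ?_⟩
  have hx2 := hx.trans_le (min_le_right _ _)
  have hh2 := hh.trans_le (min_le_right _ _)
  have m0 : x ∈ Metric.ball a r := by rw [mem_ball_iff_norm]; linarith
  have m1 : x + h ∈ Metric.ball a r := by
    rw [mem_ball_iff_norm, add_sub_right_comm]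
    exact (norm_add_le _ _).trans_lt (by linarith)
  have m2 : x - h ∈ Metric.ball a r := by
    rw [mem_ball_iff_norm, sub_right_comm]
    exact (norm_sub_le _ _).trans_lt (by linarith)
  rw [hEq' m0, hEq' m1, hEq' m2, pdList_eq_iteratedFDeriv l hcd, pdList_eq_iteratedFDeriv l hcd,
    pdList_eq_iteratedFDeriv l hcd]
  have key := hC' x h (hh.le.trans (min_le_left _ _))
  refine le_trans ?_ key
  have := ContinuousMultilinearMap.le_opNorm (iteratedFDeriv ℝ l.length F (x + h)
    - (2 : ℝ) • iteratedFDeriv ℝ l.length F x + iteratedFDeriv ℝ l.length F (x - h))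
    (fun k => EuclideanSpace.single (l.get k) (1:ℝ))
  refine le_trans (le_of_eq ?_) (this.trans (le_of_eq ?_))
  · rw [Real.norm_eq_abs]; rfl
  · simp

end ZyMain

/-- **Theorem 1.1.** For `U ⊆ ℝ^d` open and `f : U → ℝ`, `f ∘ c ∈ Z^{m,1}(ℝ)` for every smooth
curve `c : ℝ → U` if and only if `f ∈ Z^{m,1}(U)`. -/
theorem zygmund_testing_on_smooth_curves (d m : ℕ)
    (U : Set (EuclideanSpace ℝ (Fin d))) (hU : IsOpen U)
    (f : EuclideanSpace ℝ (Fin d) → ℝ) :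
    (∀ c : ℝ → EuclideanSpace ℝ (Fin d), ContDiff ℝ (⊤ : ℕ∞) c → (∀ t, c t ∈ U) →
        ZygmundClassR m (f ∘ c)) ↔
      ZygmundClassOn d m f U := by
  constructor
  · intro H
    have hloc := zy_local m U hU f H
    have hcd : ContDiffOn ℝ m f U := fun a ha => (hloc a ha).1.contDiffWithinAt
    refine ⟨hcd, fun γ hγ K hKU hK => ?_⟩
    have hlen : (zyWord γ).length = m := by rw [zyWord_length, hγ]
    have hcont : ContinuousOn (pdList (zyWord γ) f) U :=
      (pdList_contDiffOn hU (zyWord γ) 0 (by rw [hlen, zero_add]; exact hcd)).continuousOn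
    rw [pdMulti_eq]
    obtain ⟨C, hC⟩ := zy_compact (pdList (zyWord γ) f) K hK (hcont.mono hKU)
      (fun a ha => (hloc a (hKU ha)).2 _ hlen)
    exact ⟨C, fun x h h1 h2 h3 _ => hC x h h1 h2 h3⟩
  · intro h c hc hcU
    exact ZC_comp hU c hc hcU m f (ZC_of hU h)
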